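/- arXiv:1304.5468 — 2 statements merged into one kernel-verified Lean document; each statement's English description precedes it below -/
import Mathlib

section
/- For every integer r with 3 ≤ r ≤ 7, every finite simple graph G that has at least one edge and contains no K_r-minor has an edge uv such that the degree of u is at most 2r − 5 and the edge uv belongs to at most r − 3 triangles. -/
open SimpleGraph

/-- `H` is a minor of `G`: there is a family of nonempty, pairwise disjoint,
connected branch sets in `G`, one for each vertex of `H`, with an edge of `G`
between the branch sets corresponding to each edge of `H`. -/
def SimpleGraph.MinorOf {W V : Type} (H : SimpleGraph W) (G : SimpleGraph V) : Prop :=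
  ∃ f : W → Set V,
    (∀ w, (f w).Nonempty) ∧
    (∀ w, (G.induce (f w)).Connected) ∧
    (∀ w₁ w₂, w₁ ≠ w₂ → Disjoint (f w₁) (f w₂)) ∧
    (∀ w₁ w₂, H.Adj w₁ w₂ → ∃ v₁ ∈ f w₁, ∃ v₂ ∈ f w₂, G.Adj v₁ v₂)


/-- A connected vertex set, described by its subsets closed under adjacency. -/
def ConnSet {V : Type} (G : SimpleGraph V) (S : Set V) : Prop :=
  S.Nonempty ∧ ∀ T ⊆ S, T.Nonempty → (∀ x ∈ T, ∀ y ∈ S, G.Adj x y → y ∈ T) → S ⊆ T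

theorem induce_connected_iff_connSet {V : Type} (G : SimpleGraph V) (S : Set V) :
    (G.induce S).Connected ↔ ConnSet G S := by
  constructor
  · intro h
    have := h.nonempty
    refine ⟨Set.nonempty_coe_sort.1 this, ?_⟩
    rintro T hTS ⟨t, ht⟩ hcl y hy
    obtain ⟨p⟩ := h.preconnected ⟨t, hTS ht⟩ ⟨y, hy⟩
    have key : ∀ a b : S, (G.induce S).Walk a b → a.1 ∈ T → b.1 ∈ T := by
      intro a b p
      induction p with
      | nil => exact id
      | cons hadj _ ih => exact fun ha => ih (hcl _ ha _ (Subtype.property _) hadj)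
    exact key _ _ p ht
  · rintro ⟨⟨s, hs⟩, h⟩
    have : Nonempty S := ⟨⟨s, hs⟩⟩
    refine ⟨fun a b => ?_⟩
    have := h {y | ∃ hy : y ∈ S, (G.induce S).Reachable a ⟨y, hy⟩} (fun y hy => hy.1)
      ⟨a, a.2, Reachable.refl _⟩ (by
        rintro x ⟨hx, hr⟩ y hy hxy
        exact ⟨hy, hr.trans (Adj.reachable (G := G.induce S) (u := ⟨x, hx⟩) (v := ⟨y, hy⟩) hxy)⟩)
    exact (this b.2).2

theorem connSet_singleton {V : Type} (G : SimpleGraph V) (v : V) : ConnSet G {v} := by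
  refine ⟨⟨v, rfl⟩, ?_⟩
  rintro T hT ⟨t, ht⟩ _ x rfl
  exact hT ht ▸ ht

/-- A union of connected sets indexed by a connected vertex set of another graph, in which
adjacent indices give sets joined by an edge, is connected. -/
theorem ConnSet.biUnion {W V : Type} {H : SimpleGraph W} {G : SimpleGraph V} {I : Set W}
    (hI : ConnSet H I) (g : W → Set V) (hg : ∀ i ∈ I, ConnSet G (g i))
    (hadj : ∀ i ∈ I, ∀ j ∈ I, H.Adj i j → ∃ x ∈ g i, ∃ y ∈ g j, G.Adj x y) :
    ConnSet G (⋃ i ∈ I, g i) := by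
  obtain ⟨⟨i, hi⟩, hcl⟩ := hI
  obtain ⟨x, hx⟩ := (hg i hi).1
  refine ⟨⟨x, Set.mem_biUnion hi hx⟩, ?_⟩
  rintro T hTS ⟨t, ht⟩ hT
  have full : ∀ j ∈ I, (g j ∩ T).Nonempty → g j ⊆ T := by
    intro j hj hne z hz
    refine ((hg j hj).2 (g j ∩ T) Set.inter_subset_left hne ?_ hz).2
    intro a ha b hb hab
    exact ⟨hb, hT a ha.2 b (Set.mem_biUnion hj hb) hab⟩
  have hsub := hcl {j | j ∈ I ∧ g j ⊆ T} (fun j hj => hj.1) (by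
    obtain ⟨j, hj, htj⟩ := Set.mem_iUnion₂.1 (hTS ht)
    exact ⟨j, hj, full j hj ⟨t, htj, ht⟩⟩) (by
    rintro a ⟨ha, haT⟩ b hb hab
    obtain ⟨p, hp, q, hq, hpq⟩ := hadj a ha b hb hab
    exact ⟨hb, full b hb ⟨q, hq, hT p (haT hp) q (Set.mem_biUnion hb hq) hpq⟩⟩)
  intro z hz
  obtain ⟨j, hj, hzj⟩ := Set.mem_iUnion₂.1 hz
  exact (hsub hj).2 hzj

theorem ConnSet.insert_of_adj {V : Type} {G : SimpleGraph V} {S : Set V} (hS : ConnSet G S)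
    {x y : V} (hy : y ∈ S) (hxy : G.Adj x y) : ConnSet G (insert x S) := by
  refine ⟨⟨x, Set.mem_insert _ _⟩, ?_⟩
  rintro T hTS ⟨t, ht⟩ hT
  have hyT : y ∈ T → S ⊆ T := by
    intro h z hz
    refine (hS.2 (S ∩ T) Set.inter_subset_left ⟨y, hy, h⟩ ?_ hz).2
    intro a ha b hb hab
    exact ⟨hb, hT a ha.2 b (Or.inr hb) hab⟩
  have hyin : y ∈ T := by
    rcases hTS ht with rfl | htS
    · exact hT _ ht y (Or.inr hy) hxy
    · refine (hS.2 (S ∩ T) Set.inter_subset_left ⟨t, htS, ht⟩ ?_ hy).2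
      intro a ha b hb hab
      exact ⟨hb, hT a ha.2 b (Or.inr hb) hab⟩
  rintro z (rfl | hz)
  · exact hT y hyin _ (Or.inl rfl) hxy.symm
  · exact hyT hyin hz

theorem minorOf_trans {U W V : Type} {A : SimpleGraph U} {H : SimpleGraph W} {G : SimpleGraph V}
    (hAH : A.MinorOf H) (hHG : H.MinorOf G) : A.MinorOf G := by
  obtain ⟨f, -, fc, fd, fa⟩ := hAH
  obtain ⟨g, -, gc, gd, ga⟩ := hHG
  simp only [induce_connected_iff_connSet] at fc gc
  have hconn : ∀ w, ConnSet G (⋃ i ∈ f w, g i) := fun w =>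
    (fc w).biUnion g (fun i _ => gc i) (fun i _ j _ hij => ga i j hij)
  refine ⟨fun w => ⋃ i ∈ f w, g i, fun w => (hconn w).1,
    fun w => (induce_connected_iff_connSet _ _).2 (hconn w), ?_, ?_⟩
  · intro w₁ w₂ hw
    simp only [Set.disjoint_iUnion_left, Set.disjoint_iUnion_right]
    intro j hj i hi
    apply gd
    rintro rfl
    exact Set.disjoint_left.1 (fd _ _ hw) (by assumption) (by assumption)
  · intro w₁ w₂ hw
    obtain ⟨i, hi, j, hj, hij⟩ := fa _ _ hw
    obtain ⟨x, hx, y, hy, hxy⟩ := ga _ _ hij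
    exact ⟨x, Set.mem_biUnion hi hx, y, Set.mem_biUnion hj hy, hxy⟩

theorem minorOf_mono {W V : Type} {H : SimpleGraph W} {G G' : SimpleGraph V} (h : G ≤ G')
    (hm : H.MinorOf G) : H.MinorOf G' := by
  obtain ⟨f, f0, fc, fd, fa⟩ := hm
  refine ⟨f, f0, fun w => (fc w).mono (fun _ _ hxy => h hxy), fd, fun w₁ w₂ hw => ?_⟩
  obtain ⟨x, hx, y, hy, hxy⟩ := fa _ _ hw
  exact ⟨x, hx, y, hy, h hxy⟩

theorem top_minorOf_of_isClique {V : Type} {G : SimpleGraph V} {m : ℕ} {s : Finset V}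
    (hs : G.IsClique s) (hm : m ≤ s.card) : (⊤ : SimpleGraph (Fin m)).MinorOf G := by
  obtain ⟨t, hts, rfl⟩ := Finset.exists_subset_card_eq hm
  let e := t.equivFin.symm
  refine ⟨fun i => {(e i).1}, fun i => ⟨_, rfl⟩,
    fun i => (induce_connected_iff_connSet _ _).2 (connSet_singleton _ _), ?_, ?_⟩
  · intro i j hij
    simpa [Subtype.val_injective.eq_iff] using hij
  · intro i j hij
    refine ⟨_, rfl, _, rfl, hs (hts (e i).2) (hts (e j).2) ?_⟩
    simpa [Subtype.val_injective.eq_iff] using hij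

/-- The graph in which `u` inherits all neighbours of the vertices of `K`. -/
def absorb {V : Type} (G : SimpleGraph V) (u : V) (K : Set V) : SimpleGraph V where
  Adj x y := x ≠ y ∧
    (G.Adj x y ∨ (x = u ∧ ∃ z ∈ K, G.Adj z y) ∨ (y = u ∧ ∃ z ∈ K, G.Adj z x))
  symm := ⟨by
    rintro x y ⟨hne, h | h | h⟩
    · exact ⟨hne.symm, Or.inl h.symm⟩
    · exact ⟨hne.symm, Or.inr (Or.inr h)⟩
    · exact ⟨hne.symm, Or.inr (Or.inl h)⟩⟩
  loopless := ⟨fun _ h => h.1 rfl⟩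

theorem le_absorb {V : Type} (G : SimpleGraph V) (u : V) (K : Set V) : G ≤ absorb G u K :=
  fun _ _ h => ⟨h.ne, Or.inl h⟩

open Classical in
theorem absorb_induce_minorOf {V : Type} {G : SimpleGraph V} {u : V} {K S : Set V}
    (hK : ConnSet G K) (huK : u ∈ K) (hS : ∀ x ∈ S, x ∈ K → x = u) :
    ((absorb G u K).induce S).MinorOf G := by
  have hmem : ∀ x : V, x ∈ (if x = u then K else {x}) := by
    intro x
    split_ifs with h
    · exact h ▸ huK
    · rfl
  refine ⟨fun x => if x.1 = u then K else {x.1}, fun x => ⟨x.1, hmem x.1⟩, fun x => ?_, ?_, ?_⟩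
  · rw [induce_connected_iff_connSet]
    dsimp only
    split_ifs
    · exact hK
    · exact connSet_singleton _ _
  · rintro ⟨x, hx⟩ ⟨y, hy⟩ hxy
    have hxy : x ≠ y := fun h => hxy (Subtype.ext h)
    dsimp only
    split_ifs with h1 h2 h2
    · exact absurd (h1.trans h2.symm) hxy
    · exact Set.disjoint_singleton_right.2 fun h => h2 (hS y hy h)
    · exact Set.disjoint_singleton_left.2 fun h => h1 (hS x hx h)
    · simpa using hxy
  · rintro ⟨x, hx⟩ ⟨y, hy⟩ ⟨hne, h | ⟨rfl, z, hz, h⟩ | ⟨rfl, z, hz, h⟩⟩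
    · exact ⟨x, hmem x, y, hmem y, h⟩
    · exact ⟨z, by simpa using hz, y, hmem y, h⟩
    · exact ⟨x, hmem x, z, by simpa using hz, h.symm⟩

section Counting

open scoped Classical

/-- The number of neighbours of `v` inside `S`. -/
noncomputable def degIn {V : Type} (G : SimpleGraph V) (S : Finset V) (v : V) : ℕ :=
  (S.filter (G.Adj v)).card

theorem degIn_mono {V : Type} (G : SimpleGraph V) {S T : Finset V} (h : S ⊆ T) (v : V) :
    degIn G S v ≤ degIn G T v :=
  Finset.card_le_card (Finset.filter_subset_filter _ h)

theorem degIn_mono_left {V : Type} {G H : SimpleGraph V} (h : G ≤ H) (S : Finset V) (v : V) :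
    degIn G S v ≤ degIn H S v :=
  Finset.card_le_card (Finset.monotone_filter_right S fun _ _ hx => h hx)

theorem degIn_union {V : Type} (G : SimpleGraph V) {S T : Finset V} (h : Disjoint S T) (v : V) :
    degIn G (S ∪ T) v = degIn G S v + degIn G T v := by
  rw [degIn, Finset.filter_union, Finset.card_union_of_disjoint
    (Finset.disjoint_filter_filter h)]
  rfl

theorem degIn_singleton {V : Type} (G : SimpleGraph V) (x v : V) :
    degIn G {x} v = if G.Adj v x then 1 else 0 := by
  rw [degIn, Finset.filter_singleton]
  split_ifs <;> simp

theorem degIn_insert {V : Type} (G : SimpleGraph V) {S : Finset V} {y : V} (h : y ∉ S) (v : V) :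
    degIn G (insert y S) v = degIn G S v + if G.Adj v y then 1 else 0 := by
  rw [Finset.insert_eq, Finset.union_comm, degIn_union _ (by simpa using h), degIn_singleton]

theorem degIn_lt_card {V : Type} (G : SimpleGraph V) {S : Finset V} {v : V} (h : v ∈ S) :
    degIn G S v < S.card :=
  Finset.card_lt_card (Finset.filter_ssubset.2 ⟨v, h, G.irrefl⟩)

theorem sum_degIn_comm {V : Type} (G : SimpleGraph V) (S T : Finset V) :
    ∑ x ∈ S, degIn G T x = ∑ y ∈ T, degIn G S y := by
  simp only [degIn, Finset.card_filter]
  rw [Finset.sum_comm]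
  simp only [G.adj_comm]

theorem sum_degIn_union {V : Type} (G : SimpleGraph V) {S T : Finset V} (h : Disjoint S T) :
    ∑ x ∈ S ∪ T, degIn G (S ∪ T) x =
      ∑ x ∈ S, degIn G S x + ∑ x ∈ T, degIn G T x + 2 * ∑ x ∈ S, degIn G T x := by
  rw [Finset.sum_union h]
  simp only [degIn_union G h, Finset.sum_add_distrib]
  have := sum_degIn_comm G S T
  omega

theorem sum_degIn_insert {V : Type} (G : SimpleGraph V) {S : Finset V} {y : V} (h : y ∉ S) :
    ∑ x ∈ insert y S, degIn G (insert y S) x = ∑ x ∈ S, degIn G S x + 2 * degIn G S y := by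
  rw [Finset.insert_eq, sum_degIn_union _ (by simpa using h)]
  simp [degIn_singleton]

theorem sum_degIn_le {V : Type} (G : SimpleGraph V) (S : Finset V) :
    ∑ x ∈ S, degIn G S x ≤ S.card * (S.card - 1) := by
  rw [← smul_eq_mul]
  exact Finset.sum_le_card_nsmul _ _ _ fun x hx => Nat.le_sub_one_of_lt (degIn_lt_card G hx)

theorem degIn_induce {V : Type} (G : SimpleGraph V) (S : Finset V) (x : S) :
    degIn (G.induce (S : Set V)) Finset.univ x = degIn G S x := by
  rw [degIn, degIn, ← Finset.card_map (Function.Embedding.subtype _)]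
  congr 1
  ext y
  simp only [Finset.mem_map, Finset.mem_filter, Finset.mem_univ, true_and]
  constructor
  · rintro ⟨z, hz, rfl⟩
    exact ⟨z.2, hz⟩
  · rintro ⟨hy, h⟩
    exact ⟨⟨y, hy⟩, h, rfl⟩

/-- Every graph on `m` vertices with no `K_{k+2}`-minor has at most `k m - k (k + 1) / 2` edges. -/
def MinorEdgeBound (k m : ℕ) : Prop :=
  ∀ (V : Type) [Fintype V] (G : SimpleGraph V), Fintype.card V = m → k ≤ m →
    ¬ (⊤ : SimpleGraph (Fin (k + 2))).MinorOf G →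
    ∑ v, degIn G Finset.univ v + k * (k + 1) ≤ 2 * k * m

theorem MinorEdgeBound.absorb_le {k : ℕ} {V : Type} {G : SimpleGraph V} {u : V}
    {K : Set V} {S : Finset V} (hb : MinorEdgeBound k S.card) (hk : k ≤ S.card)
    (hG : ¬ (⊤ : SimpleGraph (Fin (k + 2))).MinorOf G) (hK : ConnSet G K) (huK : u ∈ K)
    (hS : ∀ x ∈ S, x ∈ K → x = u) :
    ∑ x ∈ S, degIn (absorb G u K) S x + k * (k + 1) ≤ 2 * k * S.card := by
  have := hb S ((absorb G u K).induce (S : Set V)) (Fintype.card_coe S) hk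
    fun h => hG (minorOf_trans h (absorb_induce_minorOf hK huK hS))
  rw [← Finset.sum_coe_sort]
  simpa only [← degIn_induce] using this

theorem MinorEdgeBound.sum_le {k : ℕ} {V : Type} {G : SimpleGraph V} {S : Finset V}
    (hb : MinorEdgeBound k S.card) (hk : k ≤ S.card) (hne : S.Nonempty)
    (hG : ¬ (⊤ : SimpleGraph (Fin (k + 2))).MinorOf G) :
    ∑ x ∈ S, degIn G S x + k * (k + 1) ≤ 2 * k * S.card := by
  obtain ⟨u, hu⟩ := hne
  have := hb.absorb_le hk hG (connSet_singleton G u) rfl (by simp)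
  have h2 := Finset.sum_le_sum fun x (_ : x ∈ S) => degIn_mono_left (le_absorb G u {u}) S x
  omega

theorem MinorEdgeBound.sum_le_of_nonempty {k : ℕ} {V : Type} {G : SimpleGraph V} {S : Finset V}
    (hb : MinorEdgeBound k S.card) (hk0 : 1 ≤ k) (hne : S.Nonempty)
    (hG : ¬ (⊤ : SimpleGraph (Fin (k + 2))).MinorOf G) :
    ∑ x ∈ S, degIn G S x + 2 * k ≤ 2 * k * S.card := by
  rcases le_or_gt k S.card with hk | hk
  · have := hb.sum_le hk hne hG
    nlinarith
  · have := sum_degIn_le G S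
    have h0 := hne.card_pos
    obtain ⟨s, hs⟩ := Nat.exists_eq_add_of_le' h0
    rw [hs] at this hk ⊢
    simp only [Nat.add_sub_cancel] at this
    nlinarith

/-- The set of neighbours of `v`, as a finset. -/
noncomputable def nbr {V : Type} [Fintype V] (G : SimpleGraph V) (v : V) : Finset V :=
  Finset.univ.filter (G.Adj v)

theorem mem_nbr {V : Type} [Fintype V] {G : SimpleGraph V} {v x : V} :
    x ∈ nbr G v ↔ G.Adj v x := by
  simp [nbr]

theorem card_nbr {V : Type} [Fintype V] (G : SimpleGraph V) (v : V) :
    (nbr G v).card = degIn G Finset.univ v := rfl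

theorem degIn_eq_card {V : Type} {G : SimpleGraph V} {S : Finset V} {v : V}
    (h : ∀ x ∈ S, G.Adj v x) : degIn G S v = S.card := by
  rw [degIn, Finset.filter_true_of_mem h]

theorem degIn_pos_of_adj {V : Type} [Fintype V] {G : SimpleGraph V} {v x : V} (h : G.Adj v x) :
    0 < degIn G Finset.univ v :=
  Finset.card_pos.2 ⟨x, mem_nbr.2 h⟩

theorem exists_adj_of_degIn_pos {V : Type} [Fintype V] {G : SimpleGraph V} {v : V}
    (h : 0 < degIn G Finset.univ v) : ∃ x, G.Adj v x := by
  obtain ⟨x, hx⟩ := Finset.card_pos.1 h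
  exact ⟨x, mem_nbr.1 hx⟩

theorem not_mem_nbr_self {V : Type} [Fintype V] (G : SimpleGraph V) (v : V) : v ∉ nbr G v :=
  fun h => G.irrefl (mem_nbr.1 h)

/-- If the closed neighbourhood of `x` lies in that of its neighbour `v`, and `x` has at least as
many neighbours as `v`, then the closed neighbourhoods agree. -/
theorem adj_of_closed_nbr_subset {V : Type} [Fintype V] {G : SimpleGraph V} {v x : V}
    (hvx : G.Adj v x) (hsub : ∀ y, G.Adj x y → y = v ∨ G.Adj v y)
    (hdeg : degIn G Finset.univ v ≤ degIn G Finset.univ x) {y : V} (hy : G.Adj v y)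
    (hyx : y ≠ x) : G.Adj x y := by
  have hmem : x ∈ insert v (nbr G v) := Finset.mem_insert_of_mem (mem_nbr.2 hvx)
  have hs : nbr G x ⊆ (insert v (nbr G v)).erase x := by
    intro z hz
    rw [mem_nbr] at hz
    simp only [Finset.mem_erase, Finset.mem_insert, mem_nbr]
    exact ⟨hz.ne', hsub z hz⟩
  have heq := Finset.eq_of_subset_of_card_le hs (by
    rw [Finset.card_erase_of_mem hmem, Finset.card_insert_of_notMem (not_mem_nbr_self G v),
      Nat.add_sub_cancel]
    exact hdeg)
  rw [← mem_nbr, heq]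
  simp [hyx, mem_nbr, hy]

/-- A component of the graph obtained from `G` by deleting the closed neighbourhood of `u`. -/
structure IsPiece {V : Type} (G : SimpleGraph V) (u : V) (C : Set V) : Prop where
  conn : ConnSet G C
  ne : ∀ c ∈ C, c ≠ u
  not_adj : ∀ c ∈ C, ¬ G.Adj u c
  closed : ∀ c ∈ C, ∀ z, G.Adj c z → z ∈ C ∨ G.Adj u z

theorem exists_isPiece {V : Type} {G : SimpleGraph V} {u y : V} (hy : y ≠ u)
    (hadj : ¬ G.Adj u y) : ∃ C, IsPiece G u C ∧ y ∈ C := by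
  let P : Set V → Prop := fun D => ConnSet G D ∧ y ∈ D ∧ ∀ z ∈ D, z ≠ u ∧ ¬ G.Adj u z
  have hP : P {y} := ⟨connSet_singleton G y, rfl, by rintro z rfl; exact ⟨hy, hadj⟩⟩
  refine ⟨{z | ∃ D, P D ∧ z ∈ D}, ⟨⟨⟨y, _, hP, rfl⟩, ?_⟩, ?_, ?_, ?_⟩, ⟨_, hP, rfl⟩⟩
  · rintro T hT ⟨t, ht⟩ hcl
    have hsub : ∀ D, P D → (D ∩ T).Nonempty → D ⊆ T := fun D hD hne z hz =>
      (hD.1.2 (D ∩ T) Set.inter_subset_left hne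
        (fun a ha b hb hab => ⟨hb, hcl a ha.2 b ⟨D, hD, hb⟩ hab⟩) hz).2
    obtain ⟨D, hD, htD⟩ := hT ht
    have hyT : y ∈ T := hsub D hD ⟨t, htD, ht⟩ hD.2.1
    rintro z ⟨E, hE, hz⟩
    exact hsub E hE ⟨y, hE.2.1, hyT⟩ hz
  · rintro c ⟨D, hD, hc⟩
    exact (hD.2.2 c hc).1
  · rintro c ⟨D, hD, hc⟩
    exact (hD.2.2 c hc).2
  · rintro c ⟨D, hD, hc⟩ z hcz
    by_cases hz : G.Adj u z
    · exact Or.inr hz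
    · refine Or.inl ⟨insert z D, ⟨hD.1.insert_of_adj hc hcz.symm, Or.inr hD.2.1, ?_⟩, Or.inl rfl⟩
      rintro a (rfl | ha)
      · refine ⟨?_, hz⟩
        rintro rfl
        exact (hD.2.2 c hc).2 hcz.symm
      · exact hD.2.2 a ha

theorem IsPiece.subset_of_connSet {V : Type} {G : SimpleGraph V} {u : V} {C D : Set V}
    (hC : IsPiece G u C) (hD : ConnSet G D) (hadj : ∀ z ∈ D, ¬ G.Adj u z) {d : V}
    (hdD : d ∈ D) (hdC : d ∈ C) : D ⊆ C := by
  intro z hz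
  refine (hD.2 (D ∩ C) Set.inter_subset_left ⟨d, hdD, hdC⟩ ?_ hz).2
  intro a ha b hb hab
  exact ⟨hb, (hC.closed a ha.2 b hab).resolve_right (hadj b hb)⟩

/-- A `K_{k+2}`-minor-free graph in which every edge at a vertex of degree at most `2 k - 1` lies
in at least `k` triangles, together with the edge bounds for smaller graphs and, up to one edge,
for the graph itself. -/
structure IsDense {V : Type} [Fintype V] (G : SimpleGraph V) (k : ℕ) : Prop where
  one_le : 1 ≤ k
  le_five : k ≤ 5
  minor_free : ¬ (⊤ : SimpleGraph (Fin (k + 2))).MinorOf G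
  common : ∀ u v, G.Adj u v → degIn G Finset.univ u ≤ 2 * k - 1 → k ≤ degIn G (nbr G u) v
  bound : ∀ m < Fintype.card V, MinorEdgeBound k m
  sum_univ : ∑ v, degIn G Finset.univ v + k * (k + 1) ≤ 2 * k * Fintype.card V + 2

section

variable {V : Type} [Fintype V] {G : SimpleGraph V} {k : ℕ}

theorem IsDense.sum_le (h : IsDense G k) {S : Finset V} (hS : k ≤ S.card) :
    ∑ x ∈ S, degIn G S x + k * (k + 1) ≤ 2 * k * S.card + 2 := by
  by_cases hSu : S = Finset.univ
  · subst hSu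
    exact h.sum_univ
  · have hlt : S.card < Fintype.card V := Finset.card_lt_univ_of_notMem
      (by simpa using (Finset.eq_univ_iff_forall.not.1 hSu) : ∃ x, x ∉ S).choose_spec
    have := (h.bound _ hlt).sum_le hS (Finset.card_pos.1 (h.one_le.trans hS)) h.minor_free
    omega

theorem IsDense.lt_degIn (h : IsDense G k) {u : V} (hu0 : 0 < degIn G Finset.univ u)
    (hu : degIn G Finset.univ u ≤ 2 * k - 1) : k + 1 ≤ degIn G Finset.univ u := by
  obtain ⟨x, hx⟩ := exists_adj_of_degIn_pos hu0
  have h1 := h.common u x hx hu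
  have h2 := degIn_lt_card G (mem_nbr.2 hx)
  rw [card_nbr] at h2
  omega

theorem IsDense.mul_le_sum_nbr (h : IsDense G k) {u : V}
    (hu : degIn G Finset.univ u ≤ 2 * k - 1) :
    degIn G Finset.univ u * k ≤ ∑ x ∈ nbr G u, degIn G (nbr G u) x := by
  rw [← card_nbr, ← smul_eq_mul]
  exact Finset.card_nsmul_le_sum _ _ _ fun x hx => h.common u x (mem_nbr.1 hx) hu

theorem IsDense.sum_nbr_le (h : IsDense G k) {u : V} (hu0 : 0 < degIn G Finset.univ u)
    (hu : degIn G Finset.univ u ≤ 2 * k - 1)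
    (hV : degIn G Finset.univ u + 1 < Fintype.card V) :
    ∑ x ∈ nbr G u, degIn G (nbr G u) x + 2 * degIn G Finset.univ u + k * (k + 1) ≤
      2 * k * (degIn G Finset.univ u + 1) := by
  have hc : (insert u (nbr G u)).card = degIn G Finset.univ u + 1 := by
    rw [Finset.card_insert_of_notMem (not_mem_nbr_self G u), card_nbr]
  have hk := h.lt_degIn hu0 hu
  have := (h.bound _ (hc ▸ hV)).sum_le (by omega) ⟨u, Finset.mem_insert_self _ _⟩ h.minor_free
  rwa [sum_degIn_insert _ (not_mem_nbr_self G u), hc,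
    degIn_eq_card fun x hx => mem_nbr.1 hx, card_nbr] at this

theorem IsDense.exists_low_mem_piece (h : IsDense G k) {u : V} {C : Finset V}
    (hu0 : 0 < degIn G Finset.univ u) (hu : degIn G Finset.univ u ≤ 2 * k - 1)
    (hC : IsPiece G u (C : Set V)) : ∃ v ∈ C, degIn G Finset.univ v ≤ 2 * k - 1 := by
  by_contra! hcon
  have hk1 := h.one_le
  have hk5 := h.le_five
  have huC : u ∉ C := fun hc => hC.ne u hc rfl
  have hdisj : Disjoint C (nbr G u) :=
    Finset.disjoint_left.2 fun c hc hcu => hC.not_adj c hc (mem_nbr.1 hcu)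
  have hdeg : ∀ c ∈ C, 2 * k ≤ degIn G C c + degIn G (nbr G u) c := by
    intro c hc
    have h1 := hcon c hc
    have h2 : degIn G Finset.univ c ≤ degIn G (C ∪ nbr G u) c := by
      refine Finset.card_le_card fun z hz => ?_
      have hz := (Finset.mem_filter.1 hz).2
      rw [Finset.mem_filter, Finset.mem_union, mem_nbr]
      exact ⟨hC.closed c hc z hz, hz⟩
    rw [degIn_union _ hdisj] at h2
    omega
  have hsum := Finset.card_nsmul_le_sum _ _ _ hdeg
  rw [Finset.sum_add_distrib, smul_eq_mul] at hsum
  have hCne : C.Nonempty := by simpa using hC.conn.1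
  have hweak := (h.bound _ (Finset.card_lt_univ_of_notMem huC)).sum_le_of_nonempty hk1 hCne
    h.minor_free
  have huS : u ∉ C ∪ nbr G u := by simp [huC, not_mem_nbr_self]
  have hcard : (insert u (C ∪ nbr G u)).card = C.card + degIn G Finset.univ u + 1 := by
    rw [Finset.card_insert_of_notMem huS, Finset.card_union_of_disjoint hdisj, card_nbr]
  have hlow := h.lt_degIn hu0 hu
  have hbig := h.sum_le (S := insert u (C ∪ nbr G u)) (by omega)
  have hN : degIn G Finset.univ u ≤ degIn G (C ∪ nbr G u) u := by
    rw [← card_nbr, ← degIn_eq_card fun x hx => mem_nbr.1 hx]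
    exact degIn_mono _ Finset.subset_union_right _
  rw [sum_degIn_insert _ huS, sum_degIn_union _ hdisj, hcard] at hbig
  have hnk := h.mul_le_sum_nbr hu
  generalize degIn G Finset.univ u = n at *
  clear hcon hdeg
  interval_cases k <;> interval_cases n <;> omega

theorem IsDense.exists_branch (h : IsDense G k) {u v w : V} {C K : Set V}
    (hu : degIn G Finset.univ u ≤ 2 * k - 1) (hu0 : 0 < degIn G Finset.univ u)
    (hC : IsPiece G u C) (hvC : v ∈ C) (hv : degIn G Finset.univ v ≤ 2 * k - 1)
    (hv0 : 0 < degIn G Finset.univ v)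
    (hvmin : ∀ x ∈ C, degIn G Finset.univ v ≤ degIn G Finset.univ x)
    (hK : IsPiece G v K) (huK : u ∈ K)
    (hw : ∀ x, 0 < degIn G Finset.univ x → degIn G Finset.univ w ≤ degIn G Finset.univ x)
    (hwv : w ≠ v) (hvw : ¬ G.Adj v w) :
    ∃ x y, G.Adj v x ∧ (∀ z ∈ K, ¬ G.Adj x z) ∧ y ≠ v ∧ ¬ G.Adj v y ∧ G.Adj x y := by
  by_contra! hcon
  have hk1 := h.one_le
  have hk5 := h.le_five
  have huv : u ≠ v := hK.ne u huK
  have hvu : ¬ G.Adj v u := hK.not_adj u huK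
  set N := nbr G v with hN
  set A := N.filter fun x => ∃ z ∈ K, G.Adj z x with hA
  have hAN : A ⊆ N := Finset.filter_subset _ _
  have hB : ∀ x ∈ N \ A, G.Adj v x ∧ ∀ z ∈ K, ¬ G.Adj z x := by
    intro x hx
    simp only [hA, hN, Finset.mem_sdiff, Finset.mem_filter, mem_nbr, not_and, not_exists] at hx
    exact ⟨hx.1, hx.2 hx.1⟩
  have hfull : ∀ x ∈ N \ A, ∀ y, G.Adj v y → y ≠ x → G.Adj x y := by
    intro x hx y hy hyx
    obtain ⟨hvx, hxK⟩ := hB x hx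
    refine adj_of_closed_nbr_subset hvx ?_ (hvmin x ?_) hy hyx
    · intro z hz
      by_contra! hne
      exact hcon x z hvx (fun z hz hxz => hxK z hz hxz.symm) hne.1 hne.2 hz
    · exact (hC.closed v hvC x hvx).resolve_right (hxK u huK)
  have hn : N.card = degIn G Finset.univ v := card_nbr G v
  have hab : A.card + (N \ A).card = N.card := by
    rw [add_comm, Finset.card_sdiff_add_card_eq_card hAN]
  have hlow := h.lt_degIn hv0 hv
  have hvN : v ∉ N := not_mem_nbr_self G v
  have huN : u ∉ insert v N := by simp [huv, hN, mem_nbr, hvu]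
  have hcN : (insert v N).card = N.card + 1 := Finset.card_insert_of_notMem hvN
  have hcard : (insert u (insert v N)).card = N.card + 2 := by
    rw [Finset.card_insert_of_notMem huN, hcN]
  have hle : N.card + 2 ≤ Fintype.card V := hcard ▸ Finset.card_le_univ _
  have hloc := h.sum_nbr_le hv0 hv (by omega)
  rw [← hN] at hloc
  have hsum : A.card * k + (N \ A).card * (N.card - 1) ≤ ∑ x ∈ N, degIn G N x := by
    rw [← Finset.sum_sdiff hAN, add_comm (A.card * k), ← smul_eq_mul, ← smul_eq_mul]
    refine add_le_add (Finset.card_nsmul_le_sum _ _ _ fun x hx => ?_)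
      (Finset.card_nsmul_le_sum _ _ _ fun x hx => ?_)
    · rw [← Finset.card_erase_of_mem (Finset.sdiff_subset hx)]
      refine Finset.card_le_card fun y hy => ?_
      rw [Finset.mem_erase] at hy
      exact Finset.mem_filter.2 ⟨hy.2, hfull x hx y (mem_nbr.1 hy.2) hy.1⟩
    · exact h.common v x (mem_nbr.1 (hAN hx)) hv
  rcases hle.lt_or_eq with hlt | heq
  · have hbd := (h.bound _ (hcard ▸ hlt)).absorb_le (by omega) h.minor_free hK.conn huK (by
      intro x hx hxK
      rcases Finset.mem_insert.1 hx with rfl | hx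
      · rfl
      rcases Finset.mem_insert.1 hx with rfl | hx
      · exact absurd rfl (hK.ne _ hxK)
      · exact absurd (mem_nbr.1 hx) (hK.not_adj x hxK))
    rw [sum_degIn_insert _ huN, hcard] at hbd
    have h1 : ∑ x ∈ N, degIn G N x + 2 * N.card ≤
        ∑ x ∈ insert v N, degIn (absorb G u K) (insert v N) x := by
      rw [← degIn_eq_card (S := N) fun x hx => mem_nbr.1 hx, ← sum_degIn_insert _ hvN]
      exact Finset.sum_le_sum fun x _ => degIn_mono_left (le_absorb G u K) _ x
    have h2 : A.card ≤ degIn (absorb G u K) (insert v N) u := by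
      refine Finset.card_le_card fun x hx => ?_
      obtain ⟨hxN, hx⟩ := Finset.mem_filter.1 hx
      have hxS : x ∈ insert v N := Finset.mem_insert_of_mem hxN
      refine Finset.mem_filter.2 ⟨hxS, ?_, Or.inr (Or.inl ⟨rfl, hx⟩)⟩
      rintro rfl
      exact huN hxS
    generalize (N \ A).card = b at *
    generalize A.card = a at *
    rw [← hn] at hv hlow hloc
    generalize N.card = n at *
    obtain rfl : b = n - a := by omega
    clear hcon hB hfull
    interval_cases k <;> interval_cases n <;> omega
  · have huniv : insert u (insert v N) = Finset.univ :=
      Finset.eq_univ_of_card _ (hcard.trans heq)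
    have hmem : ∀ x, x = u ∨ x = v ∨ G.Adj v x := by
      intro x
      have := Finset.mem_univ x
      rw [← huniv] at this
      simpa [hN, mem_nbr] using this
    have hKu : ∀ z ∈ K, z = u := by
      intro z hz
      rcases hmem z with h | h | h
      · exact h
      · exact absurd h (hK.ne z hz)
      · exact absurd h (hK.not_adj z hz)
    have hwu : w = u := by
      rcases hmem w with h | h | h
      · exact h
      · exact absurd h hwv
      · exact absurd h hvw
    subst hwu
    have hAu : nbr G w = A := by
      ext x
      simp only [hA, hN, Finset.mem_filter, mem_nbr]
      constructor
      · intro hx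
        refine ⟨?_, w, huK, hx⟩
        rcases hmem x with h | h | h
        · exact absurd h hx.ne'
        · exact absurd (h ▸ hx.symm) hvu
        · exact h
      · rintro ⟨-, z, hz, hzx⟩
        exact hKu z hz ▸ hzx
    have ha : A.card = degIn G Finset.univ w := by rw [← hAu, card_nbr]
    have hpos : ∀ x, 0 < degIn G Finset.univ x := by
      intro x
      rcases hmem x with h | h | h
      · exact h ▸ hu0
      · exact h ▸ hv0
      · exact degIn_pos_of_adj h.symm
    have hmin := Finset.card_nsmul_le_sum Finset.univ (fun x => degIn G Finset.univ x) _
      fun x _ => hw x (hpos x)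
    rw [smul_eq_mul, Finset.card_univ] at hmin
    have hlocu := h.sum_nbr_le hu0 hu (by have := hvmin; omega)
    have hnku := h.mul_le_sum_nbr hu
    have hlowu := h.lt_degIn hu0 hu
    have htot := h.sum_univ
    have hdegA : ∀ x ∈ A, k + (N \ A).card + 2 ≤ degIn G Finset.univ x := by
      intro x hx
      have hwx : G.Adj w x := by rwa [← hAu, mem_nbr] at hx
      have hvx : G.Adj v x := mem_nbr.1 (hAN hx)
      have h1 := h.common w x hwx hu
      rw [hAu] at h1
      have h2 : degIn G (N \ A) x = (N \ A).card := degIn_eq_card fun y hy =>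
        (hfull y hy x hvx (by rintro rfl; exact (Finset.mem_sdiff.1 hy).2 hx)).symm
      have h3 : degIn G N x = degIn G (N \ A) x + degIn G A x := by
        rw [← degIn_union _ Finset.sdiff_disjoint, Finset.sdiff_union_of_subset hAN]
      rw [← huniv, degIn_insert _ huN, degIn_insert _ hvN, if_pos hwx.symm, if_pos hvx.symm]
      omega
    have hdegB : ∀ x ∈ N \ A, N.card ≤ degIn G Finset.univ x := by
      intro x hx
      rw [hn]
      exact hvmin x ((hC.closed v hvC x (hB x hx).1).resolve_right ((hB x hx).2 w huK))
    have hsA : A.card * _ ≤ ∑ x ∈ A, degIn G Finset.univ x :=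
      Finset.card_nsmul_le_sum _ _ _ hdegA
    have hsB : (N \ A).card * _ ≤ ∑ x ∈ N \ A, degIn G Finset.univ x :=
      Finset.card_nsmul_le_sum _ _ _ hdegB
    have hsplit : ∑ x, degIn G Finset.univ x = degIn G Finset.univ w + (degIn G Finset.univ v +
        (∑ x ∈ N \ A, degIn G Finset.univ x + ∑ x ∈ A, degIn G Finset.univ x)) := by
      rw [Finset.sum_sdiff hAN, ← Finset.sum_insert hvN, ← Finset.sum_insert huN, huniv]
    rw [← heq] at hmin htot
    rw [← hn] at hv hsplit
    rw [← ha] at hu hmin hlocu hnku hlowu hsplit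
    rw [hAu] at hlocu hnku
    generalize (N \ A).card = b at *
    generalize A.card = a at *
    generalize N.card = n at *
    obtain rfl : b = n - a := by omega
    have han : a ≤ n := by omega
    clear hcon hB hfull hdegA hdegB
    interval_cases k <;> interval_cases n <;> interval_cases a <;> omega

/-- There is no piece of the complement of a closed low-degree neighbourhood that is attached
to this neighbourhood and avoids the closed neighbourhood of a vertex of minimum positive
degree. -/
theorem IsDense.not_attached_piece (h : IsDense G k) {w : V}
    (hw : ∀ x, 0 < degIn G Finset.univ x → degIn G Finset.univ w ≤ degIn G Finset.univ x)
    (n : ℕ) : ∀ (u : V) (C : Finset V), C.card = n → 0 < degIn G Finset.univ u →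
      degIn G Finset.univ u ≤ 2 * k - 1 → IsPiece G u (C : Set V) →
      (∃ c ∈ C, ∃ x, G.Adj u x ∧ G.Adj c x) → ¬ ∀ c ∈ C, c ≠ w ∧ ¬ G.Adj c w := by
  induction n using Nat.strong_induction_on with
  | _ n ih =>
    rintro u C rfl hu0 hu hC ⟨c, hc, x₀, hux₀, hcx₀⟩ hCw
    obtain ⟨v, hvC, hvmin⟩ := Finset.exists_min_image C (degIn G Finset.univ) ⟨c, hc⟩
    obtain ⟨v', hv'C, hv'⟩ := h.exists_low_mem_piece hu0 hu hC
    have hv := (hvmin v' hv'C).trans hv'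
    have hv0 : 0 < degIn G Finset.univ v := by
      by_contra hv0
      have hiso : ∀ y, ¬ G.Adj v y := fun y hy => hv0 (degIn_pos_of_adj hy)
      have := hC.conn.2 {v} (by simpa using hvC) ⟨v, rfl⟩
        (by rintro _ rfl y _ hy; exact absurd hy (hiso y)) hc
      rw [Set.mem_singleton_iff] at this
      exact hiso _ (this ▸ hcx₀)
    have huv : u ≠ v := (hC.ne v hvC).symm
    have hvu : ¬ G.Adj v u := fun hvu => hC.not_adj v hvC hvu.symm
    obtain ⟨K, hK, huK⟩ := exists_isPiece huv hvu
    obtain ⟨x, y, hvx, hxK, hyv, hvy, hxy⟩ := h.exists_branch hu hu0 hC hvC hv hv0 hvmin hK huK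
      hw (hCw v hvC).1.symm (hCw v hvC).2
    have hux : ¬ G.Adj u x := fun hux => hxK u huK hux.symm
    have hxC : x ∈ C := (hC.closed v hvC x hvx).resolve_right hux
    obtain ⟨D, hD, hyD⟩ := exists_isPiece hyv hvy
    obtain ⟨D, rfl⟩ : ∃ D' : Finset V, (D' : Set V) = D := ⟨D.toFinset, by simp⟩
    have hDK : ∀ z ∈ D, z ∉ K := fun z hzD hzK =>
      hxK y (hK.subset_of_connSet hD.conn hD.not_adj hzD hzK hyD) hxy
    have hDu : ∀ z ∈ D, ¬ G.Adj u z := fun z hzD huz =>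
      (hK.closed u huK z huz).elim (hDK z hzD) (hD.not_adj z hzD)
    have hxD : x ∉ D := fun hx => hD.not_adj x hx hvx
    have hDC : D ⊆ C := by
      have hsub := hC.subset_of_connSet (hD.conn.insert_of_adj hyD hxy) (by
        rintro z (rfl | hz)
        · exact hux
        · exact hDu z hz) (Set.mem_insert x _) hxC
      exact fun z hz => hsub (Set.mem_insert_of_mem x hz)
    exact ih D.card (Finset.card_lt_card ⟨hDC, fun hCD => hxD (hCD hxC)⟩) v D rfl hv0 hv hD
      ⟨y, hyD, x, hvx, hxy.symm⟩ fun c hc => hCw c (hDC hc)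

theorem IsDense.two_mul_le_degIn (h : IsDense G k) {u : V} (hu0 : 0 < degIn G Finset.univ u) :
    2 * k ≤ degIn G Finset.univ u := by
  by_contra! hu
  obtain ⟨w, hw, hwmin⟩ := Finset.exists_min_image
    (Finset.univ.filter fun x => 0 < degIn G Finset.univ x) (degIn G Finset.univ)
    ⟨u, by simpa using hu0⟩
  simp only [Finset.mem_filter, Finset.mem_univ, true_and] at hw hwmin
  have hwlow : degIn G Finset.univ w ≤ 2 * k - 1 := by
    have := hwmin u hu0
    omega
  obtain ⟨x, y, hwx, hyw, hwy, hxy⟩ :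
      ∃ x y, G.Adj w x ∧ y ≠ w ∧ ¬ G.Adj w y ∧ G.Adj x y := by
    by_contra! hcon
    refine h.minor_free (top_minorOf_of_isClique (s := insert w (nbr G w)) ?_ ?_)
    · rw [Finset.coe_insert, isClique_insert]
      refine ⟨?_, fun b hb _ => mem_nbr.1 hb⟩
      intro a ha b hb hab
      have ha : G.Adj w a := mem_nbr.1 ha
      refine adj_of_closed_nbr_subset ha (fun z hz => ?_)
        (hwmin a (degIn_pos_of_adj ha.symm)) (mem_nbr.1 hb) hab.symm
      by_contra! hne
      exact hcon a z ha hne.1 hne.2 hz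
    · rw [Finset.card_insert_of_notMem (not_mem_nbr_self G w), card_nbr]
      have := h.lt_degIn hw hwlow
      omega
  obtain ⟨C, hC, hyC⟩ := exists_isPiece hyw hwy
  obtain ⟨C, rfl⟩ : ∃ C' : Finset V, (C' : Set V) = C := ⟨C.toFinset, by simp⟩
  exact h.not_attached_piece hwmin _ w C rfl hw hwlow hC ⟨y, hyC, x, hwx, hxy.symm⟩
    fun c hc => ⟨hC.ne c hc, fun hcw => hC.not_adj c hc hcw.symm⟩

end

theorem exists_le_card_edgeFinset_eq {V : Type} [Fintype V] (G : SimpleGraph V) {n : ℕ}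
    (hn : n ≤ G.edgeFinset.card) : ∃ H ≤ G, H.edgeFinset.card = n := by
  obtain ⟨T, hT, rfl⟩ := Finset.exists_subset_card_eq hn
  have hT' : (T : Set (Sym2 V)) ⊆ G.edgeSet := fun e he => mem_edgeFinset.1 (hT he)
  have hcard (_ : Fintype (fromEdgeSet (T : Set (Sym2 V))).edgeSet) :
      (fromEdgeSet (T : Set (Sym2 V))).edgeFinset = T := by
    ext e
    rw [mem_edgeFinset, edgeSet_fromEdgeSet]
    exact ⟨fun he => he.1, fun he => ⟨he, G.not_isDiag_of_mem_edgeSet (hT' he)⟩⟩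
  exact ⟨fromEdgeSet T, fun x y hxy => hT' hxy.1, congrArg Finset.card (hcard _)⟩

theorem degree_eq_degIn {V : Type} [Fintype V] (G : SimpleGraph V) [DecidableRel G.Adj] (v : V) :
    G.degree v = degIn G Finset.univ v := by
  rw [degIn, ← card_neighborFinset_eq_degree]
  congr 1
  ext x
  simp

theorem ncard_inter_neighborSet {V : Type} [Fintype V] (G : SimpleGraph V) (u v : V) :
    (G.neighborSet u ∩ G.neighborSet v).ncard = degIn G (nbr G u) v := by
  rw [degIn, ← Set.ncard_coe_finset]
  congr 1
  ext x
  simp [mem_nbr]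

theorem sum_degIn_univ {V : Type} [Fintype V] (G : SimpleGraph V) :
    ∑ v, degIn G Finset.univ v = 2 * G.edgeFinset.card := by
  rw [← sum_degrees_eq_twice_card_edges]
  exact Finset.sum_congr rfl fun v _ => (degree_eq_degIn G v).symm

theorem le_degIn_nbr_of_adj {V : Type} [Fintype V] {G : SimpleGraph V} {k : ℕ}
    (hb : MinorEdgeBound k (Fintype.card V - 1)) (hk : k + 1 ≤ Fintype.card V)
    (hG : ¬ (⊤ : SimpleGraph (Fin (k + 2))).MinorOf G)
    (hsum : 2 * k * Fintype.card V < ∑ v, degIn G Finset.univ v + k * (k + 1)) {x y : V}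
    (hxy : G.Adj x y) : k ≤ degIn G (nbr G x) y := by
  set R := (Finset.univ.erase y).erase x with hR
  have hxR : x ∉ R := Finset.notMem_erase _ _
  have hxyR : insert x R = Finset.univ.erase y :=
    Finset.insert_erase (Finset.mem_erase.2 ⟨hxy.ne, Finset.mem_univ x⟩)
  have hyR : y ∉ insert x R := hxyR ▸ Finset.notMem_erase _ _
  have huniv : insert y (insert x R) = Finset.univ := by
    rw [hxyR, Finset.insert_erase (Finset.mem_univ y)]
  have hcard : (insert x R).card = Fintype.card V - 1 := by
    rw [hxyR, Finset.card_erase_of_mem (Finset.mem_univ y), Finset.card_univ]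
  have hbd := (hcard ▸ hb).absorb_le (by omega) hG
    ((connSet_singleton G y).insert_of_adj rfl hxy) (Set.mem_insert x _) (by
      rintro z hz (rfl | rfl)
      · rfl
      · exact absurd hz hyR)
  rw [sum_degIn_insert _ hxR, hcard] at hbd
  have h1 := Finset.sum_le_sum fun z (_ : z ∈ R) =>
    degIn_mono_left (le_absorb G x (insert x {y})) R z
  have h2 : degIn G R x + degIn G R y ≤
      degIn (absorb G x (insert x {y})) R x + degIn G (nbr G x) y := by
    rw [degIn, degIn, ← Finset.card_union_add_card_inter]
    refine add_le_add (Finset.card_le_card fun z hz => ?_) (Finset.card_le_card fun z hz => ?_)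
    · rw [Finset.mem_union, Finset.mem_filter, Finset.mem_filter] at hz
      rcases hz with ⟨hzR, hz⟩ | ⟨hzR, hz⟩
      · exact Finset.mem_filter.2 ⟨hzR, le_absorb _ _ _ hz⟩
      · refine Finset.mem_filter.2 ⟨hzR, ?_, Or.inr (Or.inl ⟨rfl, y, by simp, hz⟩)⟩
        rintro rfl
        exact hxR hzR
    · simp only [Finset.mem_inter, Finset.mem_filter] at hz
      exact Finset.mem_filter.2 ⟨mem_nbr.2 hz.1.2, hz.2.2⟩
  rw [← huniv, sum_degIn_insert _ hyR, sum_degIn_insert _ hxR, degIn_insert _ hxR,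
    if_pos hxy.symm] at hsum
  obtain ⟨m, hm⟩ := Nat.exists_eq_add_of_le' (show 1 ≤ Fintype.card V by omega)
  rw [hm, Nat.add_sub_cancel] at hbd
  rw [hm] at hsum
  nlinarith

theorem minorEdgeBound_of_le_five {k : ℕ} (hk1 : 1 ≤ k) (hk5 : k ≤ 5) (m : ℕ) :
    MinorEdgeBound k m := by
  induction m using Nat.strong_induction_on with
  | _ m ih =>
    rintro V _ G rfl hkm hG
    by_contra! hlt
    have hkm' : k + 1 ≤ Fintype.card V := by
      by_contra! hle
      have := sum_degIn_le G Finset.univ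
      obtain rfl : k = Fintype.card V := by omega
      rw [Finset.card_univ] at this
      obtain ⟨s, hs⟩ := Nat.exists_eq_add_of_le' hk1
      rw [hs] at this hlt
      simp only [Nat.add_sub_cancel] at this
      nlinarith
    obtain ⟨H, hHG, hH⟩ : ∃ H ≤ G,
        ∑ v, degIn H Finset.univ v + k * (k + 1) = 2 * k * Fintype.card V + 2 := by
      rw [sum_degIn_univ] at hlt
      obtain ⟨e, he⟩ : ∃ e, 2 * e + k * (k + 1) = 2 * k * Fintype.card V + 2 := by
        refine ⟨k * Fintype.card V + 1 - k * (k + 1) / 2, ?_⟩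
        interval_cases k <;> omega
      obtain ⟨H, hHG, hH⟩ := exists_le_card_edgeFinset_eq G (n := e) (by
        have := (Nat.even_mul_succ_self k).two_dvd
        have h2 : 2 * k * Fintype.card V = 2 * (k * Fintype.card V) := by ring
        omega)
      exact ⟨H, hHG, by rw [sum_degIn_univ, hH, he]⟩
    have hHfree : ¬ (⊤ : SimpleGraph (Fin (k + 2))).MinorOf H :=
      fun hm => hG (minorOf_mono hHG hm)
    have hb := ih (Fintype.card V - 1) (by omega)
    have hcommon : ∀ x y, H.Adj x y → k ≤ degIn H (nbr H x) y := fun x y hxy =>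
      le_degIn_nbr_of_adj hb hkm' hHfree (by omega) hxy
    have hdense : IsDense H k := ⟨hk1, hk5, hHfree, fun x y hxy _ => hcommon x y hxy, ih, hH.le⟩
    have hpos : ∀ v, 0 < degIn H Finset.univ v := by
      intro v
      by_contra! hv
      have hvR := Finset.notMem_erase v Finset.univ
      have hc : (Finset.univ.erase v).card = Fintype.card V - 1 := by
        rw [Finset.card_erase_of_mem (Finset.mem_univ v), Finset.card_univ]
      have hbd := (hc ▸ hb).sum_le (by omega) (Finset.card_pos.1 (by omega)) hHfree
      have hsum := sum_degIn_insert H hvR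
      rw [Finset.insert_erase (Finset.mem_univ v)] at hsum
      have hle := degIn_mono H (Finset.subset_univ (Finset.univ.erase v)) v
      have hmul := Nat.mul_le_mul_left (2 * k) (hc.le.trans (Nat.sub_le _ 1))
      omega
    have hsum : _ ≤ ∑ v, degIn H Finset.univ v := Finset.card_nsmul_le_sum _ _ _
      fun v _ => hdense.two_mul_le_degIn (hpos v)
    rw [smul_eq_mul, Finset.card_univ, mul_comm] at hsum
    obtain rfl : k = 1 := by
      by_contra hne
      have : 2 * 3 ≤ k * (k + 1) := Nat.mul_le_mul (by omega) (by omega)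
      omega
    obtain ⟨v⟩ : Nonempty V := Fintype.card_pos_iff.1 (by omega)
    obtain ⟨x, hvx⟩ := exists_adj_of_degIn_pos (hpos v)
    obtain ⟨y, hy⟩ := Finset.card_pos.1 (hcommon v x hvx)
    rw [Finset.mem_filter, mem_nbr] at hy
    refine hHfree (top_minorOf_of_isClique (s := {v, x, y}) ?_ ?_)
    · simp [isClique_insert, hvx, hy.1, hy.2]
    · rw [Finset.card_eq_three.2 ⟨v, x, y, hvx.ne, hy.1.ne, hy.2.ne, rfl⟩]

end Counting

/-- For every `3 ≤ r ≤ 7`, every finite simple graph with at least one edge and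
no `K_r`-minor has an edge `uv` with `deg u ≤ 2r - 5` lying in at most `r - 3`
triangles. -/
theorem statement0 {V : Type} [Fintype V] (G : SimpleGraph V) [DecidableRel G.Adj]
    (r : ℕ) (hr3 : 3 ≤ r) (hr7 : r ≤ 7)
    (hedge : G.edgeSet.Nonempty)
    (hfree : ¬ (⊤ : SimpleGraph (Fin r)).MinorOf G) :
    ∃ u v : V, G.Adj u v ∧ G.degree u ≤ 2 * r - 5 ∧
      (G.neighborSet u ∩ G.neighborSet v).ncard ≤ r - 3 := by
  obtain ⟨k, rfl⟩ : ∃ k, r = k + 2 := ⟨r - 2, by omega⟩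
  have hk1 : 1 ≤ k := by omega
  have hbound := minorEdgeBound_of_le_five hk1 (by omega : k ≤ 5)
  by_contra! hcon
  have hcommon : ∀ u v, G.Adj u v → degIn G Finset.univ u ≤ 2 * k - 1 →
      k ≤ degIn G (nbr G u) v := by
    intro u v huv hu
    have h1 := hcon u v huv (by rw [degree_eq_degIn]; omega)
    rw [ncard_inter_neighborSet] at h1
    omega
  classical
  set S := Finset.univ.filter fun v => 0 < degIn G Finset.univ v with hS
  obtain ⟨⟨a, b⟩, hab⟩ := hedge
  have hab : G.Adj a b := hab
  have haS : a ∈ S := by simpa [hS] using degIn_pos_of_adj hab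
  have hdegS : ∀ v, degIn G Finset.univ v ≤ degIn G S v := by
    intro v
    refine Finset.card_le_card fun z hz => ?_
    have hz : G.Adj v z := mem_nbr.1 hz
    simpa [hS, hz] using degIn_pos_of_adj hz.symm
  by_cases hk : k ≤ Fintype.card V
  · have hdense : IsDense G k := ⟨hk1, by omega, hfree, hcommon, fun m _ => hbound m, by
      have := hbound _ V G rfl hk hfree
      omega⟩
    have hsum : _ ≤ ∑ v ∈ S, degIn G S v := Finset.card_nsmul_le_sum _ _ (2 * k) fun v hv =>
      (hdense.two_mul_le_degIn (by simpa [hS] using hv)).trans (hdegS v)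
    have hweak := (hbound S.card).sum_le_of_nonempty hk1 ⟨a, haS⟩ hfree
    rw [smul_eq_mul, mul_comm] at hsum
    omega
  · have h1 := degIn_lt_card G (Finset.mem_univ a)
    rw [Finset.card_univ] at h1
    have h2 := hcommon a b hab (by omega)
    have h3 := degIn_mono G (Finset.subset_univ (nbr G a)) b
    have h4 := degIn_lt_card G (Finset.mem_univ b)
    rw [Finset.card_univ] at h4
    omega
end

section
/- For every integer k with 4 ≤ k ≤ 7, every finite simple graph with m ≥ 1 edges and at least m(k−3)/2 triangles has a K_k-minor. -/
open SimpleGraph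

namespace SimpleGraph

section CliqueMinor

open Classical

variable {V : Type}

/-- `G` has a `K_k`-minor. -/
def HasCliqueMinor (G : SimpleGraph V) (k : ℕ) : Prop :=
  (⊤ : SimpleGraph (Fin k)).MinorOf G

/-- The graph on the same vertex set keeping only the edges of `G` inside `S`. -/
def restrict (G : SimpleGraph V) (S : Set V) : SimpleGraph V where
  Adj x y := G.Adj x y ∧ x ∈ S ∧ y ∈ S
  symm := ⟨fun _ _ h => ⟨h.1.symm, h.2.2, h.2.1⟩⟩
  loopless := ⟨fun x h => G.loopless.irrefl x h.1⟩

/-- The graph on the same vertex set in which `u` has inherited the neighbours of `v`, and `v` has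
become isolated. For adjacent `u` and `v` this is the contraction of the edge `uv`. -/
def contract (G : SimpleGraph V) (u v : V) : SimpleGraph V where
  Adj x y := x ≠ y ∧ x ≠ v ∧ y ≠ v ∧ (G.Adj x y ∨ (x = u ∧ G.Adj v y) ∨ (y = u ∧ G.Adj v x))
  symm := ⟨fun x y ⟨h1, h2, h3, h4⟩ => ⟨h1.symm, h3, h2, by
    rcases h4 with h | h | h
    · exact .inl h.symm
    · exact .inr (.inr h)
    · exact .inr (.inl h)⟩⟩
  loopless := ⟨fun x h => h.1 rfl⟩

lemma restrict_le (G : SimpleGraph V) (S : Set V) : G.restrict S ≤ G := fun _ _ h => h.1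

lemma connected_induce_of_forall_reachable {H G : SimpleGraph V} {s t : Set V}
    (hs : (H.induce s).Connected) (hst : s ⊆ t)
    (hstep : ∀ x (hx : x ∈ s) y (hy : y ∈ s), H.Adj x y →
      (G.induce t).Reachable ⟨x, hst hx⟩ ⟨y, hst hy⟩)
    (hrest : ∀ y (hy : y ∈ t), ∃ x, ∃ hx : x ∈ s,
      (G.induce t).Reachable ⟨x, hst hx⟩ ⟨y, hy⟩) :
    (G.induce t).Connected := by
  have key : ∀ a b : s, (H.induce s).Reachable a b →
      (G.induce t).Reachable ⟨a, hst a.2⟩ ⟨b, hst b.2⟩ := by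
    rintro a b ⟨p⟩
    induction p with
    | nil => exact Reachable.rfl
    | cons h _ ih => exact (hstep _ (Subtype.prop _) _ (Subtype.prop _) h).trans ih
  obtain ⟨z⟩ := hs.nonempty
  refine connected_iff_exists_forall_reachable _ |>.2 ⟨⟨z, hst z.2⟩, ?_⟩
  rintro ⟨y, hy⟩
  obtain ⟨x, hx, hxy⟩ := hrest y hy
  exact (key z ⟨x, hx⟩ (hs.preconnected _ _)).trans hxy

lemma connected_induce_insert {G : SimpleGraph V} {s : Set V} {u v : V}
    (hs : (G.induce s).Connected) (hu : u ∈ s) (huv : G.Adj u v) :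
    (G.induce (insert v s)).Connected := by
  refine connected_induce_of_forall_reachable hs (Set.subset_insert v s)
    (fun x hx y hy h => Adj.reachable (by exact h)) ?_
  rintro y (rfl | hy)
  · exact ⟨u, hu, Adj.reachable (by exact huv)⟩
  · exact ⟨y, hy, Reachable.rfl⟩

lemma HasCliqueMinor.mono {H G : SimpleGraph V} {k : ℕ} (hle : H ≤ G) (h : H.HasCliqueMinor k) :
    G.HasCliqueMinor k := by
  obtain ⟨f, h1, h2, h3, h4⟩ := h
  refine ⟨f, h1, fun w => ?_, h3, fun w₁ w₂ hw => ?_⟩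
  · exact (h2 w).mono (fun x y hxy => hle hxy)
  · obtain ⟨x, hx, y, hy, hxy⟩ := h4 w₁ w₂ hw
    exact ⟨x, hx, y, hy, hle hxy⟩

lemma HasCliqueMinor.of_contract {G : SimpleGraph V} {k : ℕ} {u v : V} (huv : G.Adj u v)
    (hk : 2 ≤ k) (h : (G.contract u v).HasCliqueMinor k) : G.HasCliqueMinor k := by
  obtain ⟨f, h1, h2, h3, h4⟩ := h
  have hv : ∀ w, v ∉ f w := by
    intro w hvw
    have : Nontrivial (Fin k) := Fin.nontrivial_iff_two_le.2 hk
    obtain ⟨w', hw'⟩ := exists_ne w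
    obtain ⟨x, hx, y, hy, hxy⟩ := h4 w w' hw'.symm
    have : Nontrivial (f w) := ⟨⟨v, hvw⟩, ⟨x, hx⟩, fun h => hxy.2.1 (congrArg Subtype.val h).symm⟩
    obtain ⟨z, hz⟩ := (h2 w).preconnected.exists_adj_of_nontrivial ⟨v, hvw⟩
    exact hz.2.1 rfl
  refine ⟨fun w => if u ∈ f w then insert v (f w) else f w, fun w => ?_, fun w => ?_,
    fun w₁ w₂ hw => ?_, fun w₁ w₂ hw => ?_⟩
  · dsimp only
    split_ifs
    · exact Set.insert_nonempty _ _
    · exact h1 w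
  · by_cases hu : u ∈ f w
    · beta_reduce
      rw [if_pos hu]
      have huv' : ((G.induce (insert v (f w))).Adj ⟨u, .inr hu⟩ ⟨v, .inl rfl⟩) := huv
      refine connected_induce_of_forall_reachable (h2 w) (Set.subset_insert _ _) ?_ ?_
      · rintro x hx y hy ⟨-, -, -, h | ⟨rfl, h⟩ | ⟨rfl, h⟩⟩
        · exact Adj.reachable (by exact h)
        · exact huv'.reachable.trans (Adj.reachable (by exact h))
        · exact (huv'.reachable.trans (Adj.reachable (by exact h))).symm
      · rintro y (rfl | hy)
        · exact ⟨u, hu, huv'.reachable⟩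
        · exact ⟨y, hy, Reachable.rfl⟩
    · beta_reduce
      rw [if_neg hu]
      refine (h2 w).mono ?_
      rintro ⟨x, hx⟩ ⟨y, hy⟩ ⟨-, -, -, h | ⟨h, -⟩ | ⟨h, -⟩⟩
      · exact h
      · exact absurd (by simpa [← h] using hx) hu
      · exact absurd (by simpa [← h] using hy) hu
  · have hd := h3 w₁ w₂ hw
    have := hv w₁
    have := hv w₂
    rw [Set.disjoint_left] at hd ⊢
    dsimp only
    split_ifs with ha hb hb
    · exact absurd hb (hd ha)
    all_goals
      intro x hx
      have := @hd x
      aesop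
  · have hsub : ∀ w, f w ⊆ (if u ∈ f w then insert v (f w) else f w) := by
      intro w
      split_ifs
      · exact Set.subset_insert _ _
      · exact le_rfl
    obtain ⟨x, hx, y, hy, -, -, -, h | ⟨rfl, h⟩ | ⟨rfl, h⟩⟩ := h4 w₁ w₂ hw
    · exact ⟨x, hsub _ hx, y, hsub _ hy, h⟩
    · exact ⟨v, by simp [hx], y, hsub _ hy, h⟩
    · exact ⟨x, hsub _ hx, v, by simp [hy], h.symm⟩

lemma hasCliqueMinor_of_isClique {G : SimpleGraph V} {S : Finset V} {k : ℕ}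
    (hS : G.IsClique S) (hk : k ≤ S.card) : G.HasCliqueMinor k := by
  obtain ⟨T, hT, rfl⟩ := Finset.exists_subset_card_eq hk
  refine ⟨fun w => {(T.equivFin.symm w : V)}, fun w => Set.singleton_nonempty _, fun w => ?_,
    fun w₁ w₂ hw => ?_, fun w₁ w₂ hw => ⟨_, rfl, _, rfl, ?_⟩⟩
  · exact ⟨Preconnected.of_subsingleton⟩
  · simpa [Subtype.ext_iff] using hw
  · refine hS (hT (Subtype.prop _)) (hT (Subtype.prop _)) ?_
    simpa [Subtype.ext_iff] using hw

/-- A complete minor of `G` inside `A` gains two vertices from two further disjoint connected sets,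
adjacent to each other and to every vertex set meeting `A`. -/
lemma HasCliqueMinor.add_two {G : SimpleGraph V} {k : ℕ} {A P Q : Set V} (hk : 2 ≤ k)
    (h : (G.restrict A).HasCliqueMinor k) (hP : (G.induce P).Connected)
    (hQ : (G.induce Q).Connected) (hPQ : Disjoint P Q) (hPA : Disjoint P A) (hQA : Disjoint Q A)
    (hadj : ∃ x ∈ P, ∃ y ∈ Q, G.Adj x y) (hP' : ∀ a ∈ A, ∃ x ∈ P, G.Adj x a)
    (hQ' : ∀ a ∈ A, ∃ x ∈ Q, G.Adj x a) : G.HasCliqueMinor (k + 2) := by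
  obtain ⟨f, h1, h2, h3, h4⟩ := h
  have hfA : ∀ w, f w ⊆ A := by
    intro w x hx
    have : Nontrivial (Fin k) := Fin.nontrivial_iff_two_le.2 hk
    obtain ⟨w', hw'⟩ := exists_ne w
    obtain ⟨y, hy, z, hz, hyz⟩ := h4 w w' hw'.symm
    by_cases hxy : x = y
    · exact hxy ▸ hyz.2.1
    · have : Nontrivial (f w) := ⟨⟨x, hx⟩, ⟨y, hy⟩, fun h => hxy (congrArg Subtype.val h)⟩
      obtain ⟨z, hz⟩ := (h2 w).preconnected.exists_adj_of_nontrivial ⟨x, hx⟩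
      exact hz.2.1
  have hPf : ∀ w, ∃ x ∈ P, ∃ y ∈ f w, G.Adj x y := fun w => by
    obtain ⟨a, ha⟩ := h1 w
    obtain ⟨x, hx, hxa⟩ := hP' a (hfA w ha)
    exact ⟨x, hx, a, ha, hxa⟩
  have hQf : ∀ w, ∃ x ∈ Q, ∃ y ∈ f w, G.Adj x y := fun w => by
    obtain ⟨a, ha⟩ := h1 w
    obtain ⟨x, hx, hxa⟩ := hQ' a (hfA w ha)
    exact ⟨x, hx, a, ha, hxa⟩
  have hswap : ∀ {X Y : Set V}, (∃ x ∈ X, ∃ y ∈ Y, G.Adj x y) → ∃ y ∈ Y, ∃ x ∈ X, G.Adj y x :=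
    fun ⟨x, hx, y, hy, hxy⟩ => ⟨y, hy, x, hx, hxy.symm⟩
  refine ⟨Fin.cons P (Fin.cons Q f), fun w => ?_, fun w => ?_, fun w₁ w₂ => ?_, fun w₁ w₂ => ?_⟩
  · refine Fin.cases ?_ (fun w => Fin.cases ?_ (fun w => ?_) w) w
    · exact Set.nonempty_coe_sort.1 hP.nonempty
    · exact Set.nonempty_coe_sort.1 hQ.nonempty
    · exact h1 w
  · refine Fin.cases ?_ (fun w => Fin.cases ?_ (fun w => ?_) w) w
    · exact hP
    · exact hQ
    · exact (h2 w).mono (fun x y hxy => restrict_le G A hxy)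
  · refine Fin.cases ?_ (fun w₁ => Fin.cases ?_ (fun w₁ => ?_) w₁) w₁ <;>
    refine Fin.cases ?_ (fun w₂ => Fin.cases ?_ (fun w₂ => ?_) w₂) w₂ <;>
    simp only [Fin.cons_zero, Fin.cons_succ, ne_eq, not_true_eq_false, false_imp_iff,
      Fin.succ_inj]
    · exact fun _ => hPQ
    · exact fun _ => hPA.mono_right (hfA _)
    · exact fun _ => hPQ.symm
    · exact fun _ => hQA.mono_right (hfA _)
    · exact fun _ => (hPA.mono_right (hfA _)).symm
    · exact fun _ => (hQA.mono_right (hfA _)).symm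
    · exact h3 _ _
  · refine Fin.cases ?_ (fun w₁ => Fin.cases ?_ (fun w₁ => ?_) w₁) w₁ <;>
    refine Fin.cases ?_ (fun w₂ => Fin.cases ?_ (fun w₂ => ?_) w₂) w₂ <;>
    simp only [Fin.cons_zero, Fin.cons_succ, top_adj, ne_eq, not_true_eq_false, false_imp_iff,
      Fin.succ_inj]
    · exact fun _ => hadj
    · exact fun _ => hPf _
    · exact fun _ => hswap hadj
    · exact fun _ => hQf _
    · exact fun _ => hswap (hPf _)
    · exact fun _ => hswap (hQf _)
    · intro hw
      obtain ⟨x, hx, y, hy, hxy⟩ := h4 w₁ w₂ hw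
      exact ⟨x, hx, y, hy, hxy.1⟩

lemma mem_erase_of_adj {G : SimpleGraph V} {S : Finset V} (hS : ∀ x y, G.Adj x y → x ∈ S) {v : V}
    (hv : ∀ y, ¬ G.Adj v y) (x y : V) (h : G.Adj x y) : x ∈ S.erase v :=
  Finset.mem_erase.2 ⟨fun hx => hv y (hx ▸ h), hS x y h⟩

lemma mem_erase_of_contract_adj {G : SimpleGraph V} {S : Finset V}
    (hS : ∀ x y, G.Adj x y → x ∈ S) {u v : V} (huv : G.Adj u v) (x y : V)
    (h : (G.contract u v).Adj x y) : x ∈ S.erase v := by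
  obtain ⟨-, hxv, -, h | ⟨rfl, -⟩ | ⟨-, h⟩⟩ := h
  · exact Finset.mem_erase.2 ⟨hxv, hS x y h⟩
  · exact Finset.mem_erase.2 ⟨hxv, hS x v huv⟩
  · exact Finset.mem_erase.2 ⟨hxv, hS x v h.symm⟩

variable [Fintype V]

/-- The set of neighbours of `x`. -/
noncomputable def nbr (G : SimpleGraph V) (x : V) : Finset V := {y | G.Adj x y}

/-- The sum of the degrees, which is twice the number of edges. -/
noncomputable def degSum (G : SimpleGraph V) : ℕ := ∑ x, (G.nbr x).card

@[simp] lemma mem_nbr {G : SimpleGraph V} {x y : V} : y ∈ G.nbr x ↔ G.Adj x y := by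
  simp [nbr]

lemma notMem_nbr_self (G : SimpleGraph V) (x : V) : x ∉ G.nbr x := by simp

lemma degSum_eq_two_mul (G : SimpleGraph V) [Fintype G.edgeSet] :
    G.degSum = 2 * G.edgeFinset.card := by
  convert G.sum_degrees_eq_twice_card_edges using 1
  · refine Finset.sum_congr rfl fun x _ => ?_
    rw [← card_neighborFinset_eq_degree]
    congr 1
    ext
    simp
  · congr!

lemma even_degSum (G : SimpleGraph V) : Even G.degSum := by
  rw [degSum_eq_two_mul]
  exact even_two_mul _

lemma nbr_restrict_of_mem {G : SimpleGraph V} {S : Finset V} {x : V} (hx : x ∈ S) :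
    (G.restrict S).nbr x = G.nbr x ∩ S := by
  ext y
  simp [restrict, hx]

lemma degSum_restrict (G : SimpleGraph V) (S : Finset V) :
    (G.restrict S).degSum = ∑ x ∈ S, (G.nbr x ∩ S).card := by
  unfold degSum
  rw [← Finset.sum_subset S.subset_univ]
  · exact Finset.sum_congr rfl fun x hx => by rw [nbr_restrict_of_mem hx]
  · intro x _ hx
    rw [Finset.card_eq_zero, Finset.eq_empty_iff_forall_notMem]
    intro y hy
    exact hx (mem_nbr.1 hy).2.1

lemma degSum_contract {G : SimpleGraph V} {u v : V} (huv : G.Adj u v) :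
    G.degSum = (G.contract u v).degSum + 2 + 2 * (G.nbr u ∩ G.nbr v).card := by
  have hne : u ≠ v := huv.ne
  have huniv : (Finset.univ : Finset V) = insert u (insert v (Finset.univ \ {u, v})) := by
    ext x
    simp
    tauto
  have hsum : ∀ f : V → ℕ, ∑ x, f x = f u + (f v + ∑ x ∈ Finset.univ \ {u, v}, f x) := by
    intro f
    rw [huniv, Finset.sum_insert (by simp [hne]), Finset.sum_insert (by simp)]
    congr 3
    ext x
    simp
    tauto
  have hv : (G.contract u v).nbr v = ∅ := by
    ext x
    simp [contract]
  have hu : (G.contract u v).nbr u = (G.nbr u ∪ G.nbr v) \ {u, v} := by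
    ext x
    have := G.ne_of_adj (a := u) (b := x)
    simp only [mem_nbr, contract, Finset.mem_sdiff, Finset.mem_union, Finset.mem_insert,
      Finset.mem_singleton]
    tauto
  have hrest : ∀ x ∈ Finset.univ \ {u, v}, (G.nbr x).card =
      ((G.contract u v).nbr x).card + if x ∈ G.nbr u ∩ G.nbr v then 1 else 0 := by
    intro x hx
    simp only [Finset.mem_sdiff, Finset.mem_univ, true_and, Finset.mem_insert,
      Finset.mem_singleton, not_or] at hx
    by_cases hvx : G.Adj x v
    · have h1 : (G.contract u v).nbr x = insert u ((G.nbr x).erase v) := by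
        ext y
        have := G.ne_of_adj (a := x) (b := y)
        have := hvx.symm
        simp only [mem_nbr, contract, Finset.mem_insert, Finset.mem_erase]
        by_cases hy : y = u
        · subst hy; tauto
        · tauto
      have h2 : v ∈ G.nbr x := by simpa
      by_cases hux : G.Adj x u
      · rw [h1, Finset.insert_eq_of_mem (by simp [hne, hux]), Finset.card_erase_add_one h2 |>.symm]
        simp [hux.symm, hvx.symm]
      · rw [h1, Finset.card_insert_of_notMem (by simp [hux]), Finset.card_erase_add_one h2]
        simp [G.adj_comm u x, hux]
    · have h1 : (G.contract u v).nbr x = G.nbr x := by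
        ext y
        have h1 := G.ne_of_adj (a := x) (b := y)
        have h2 : ¬ G.Adj v x := fun h => hvx h.symm
        have h3 : G.Adj x y → y ≠ v := by rintro h rfl; exact hvx h
        simp only [mem_nbr, contract]
        tauto
      simp [h1, G.adj_comm v x, hvx]
  have hcard : ((G.nbr u ∪ G.nbr v) \ {u, v}).card + 2 = (G.nbr u ∪ G.nbr v).card := by
    rw [← Finset.card_pair hne]
    refine Finset.card_sdiff_add_card_eq_card ?_
    intro x
    simp only [Finset.mem_insert, Finset.mem_singleton, Finset.mem_union, mem_nbr]
    rintro (rfl | rfl)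
    · exact .inr huv.symm
    · exact .inl huv
  have hinter : ∑ x ∈ Finset.univ \ {u, v}, (if x ∈ G.nbr u ∩ G.nbr v then 1 else 0) =
      (G.nbr u ∩ G.nbr v).card := by
    rw [Finset.sum_ite_mem, Finset.sum_const, smul_eq_mul, mul_one]
    congr 1
    ext x
    have h1 := G.ne_of_adj (a := u) (b := x)
    have h2 := G.ne_of_adj (a := v) (b := x)
    simp only [Finset.mem_inter, Finset.mem_sdiff, Finset.mem_univ, Finset.mem_insert,
      Finset.mem_singleton, mem_nbr, true_and]
    tauto
  have := Finset.card_union_add_card_inter (G.nbr u) (G.nbr v)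
  unfold degSum
  rw [hsum, hsum fun x => ((G.contract u v).nbr x).card, Finset.sum_congr rfl hrest,
    Finset.sum_add_distrib, hinter, hu, hv]
  simp only [Finset.card_empty]
  omega

lemma degSum_restrict_contract_ge {G : SimpleGraph V} {v s : V} {C S : Finset V} (hvC : v ∉ C)
    (hS : S ⊆ G.nbr v) (hCS : Disjoint C S) (hC : ∀ x ∈ C, G.nbr x ⊆ C ∪ S) (hs : s ∈ S) :
    ∑ x ∈ C, (G.nbr x).card + ∑ x ∈ S, (G.nbr x ∩ (C ∪ S)).card +
      2 * (S \ insert s (G.nbr s)).card ≤ ((G.contract s v).restrict ↑(C ∪ S)).degSum := by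
  have hvS : v ∉ S := fun h => G.notMem_nbr_self v (hS h)
  have hvT : v ∉ C ∪ S := by simp [hvC, hvS]
  have hsub : ∀ x ∈ C ∪ S, G.nbr x ∩ (C ∪ S) ⊆ (G.contract s v).nbr x ∩ (C ∪ S) := by
    intro x hx y hy
    rw [Finset.mem_inter, mem_nbr] at hy ⊢
    exact ⟨⟨hy.1.ne, fun h => hvT (h ▸ hx), fun h => hvT (h ▸ hy.2), .inl hy.1⟩, hy.2⟩
  have hadj : ∀ x ∈ S, x ≠ s → (G.contract s v).Adj s x := fun x hx hxs =>
    ⟨hxs.symm, fun h => hvS (h ▸ hs), fun h => hvS (h ▸ hx), .inr (.inl ⟨rfl, mem_nbr.1 (hS hx)⟩)⟩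
  have h1 : ∑ x ∈ C, (G.nbr x).card ≤ ∑ x ∈ C, ((G.contract s v).nbr x ∩ (C ∪ S)).card := by
    refine Finset.sum_le_sum fun x hx => Finset.card_le_card ?_
    refine subset_trans ?_ (hsub x (Finset.mem_union_left _ hx))
    exact Finset.subset_inter subset_rfl (hC x hx)
  have h2 : ∀ x ∈ S, (G.nbr x ∩ (C ∪ S)).card +
      ((if x ∈ S \ insert s (G.nbr s) then 1 else 0) +
        if x = s then (S \ insert s (G.nbr s)).card else 0) ≤
      ((G.contract s v).nbr x ∩ (C ∪ S)).card := by
    intro x hx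
    by_cases hxs : x = s
    · subst hxs
      simp only [Finset.mem_sdiff, Finset.mem_insert_self, not_true_eq_false, and_false, if_false,
        if_true, zero_add]
      rw [← Finset.card_union_of_disjoint]
      · refine Finset.card_le_card (Finset.union_subset (hsub x (Finset.mem_union_right _ hx)) ?_)
        intro y hy
        simp only [Finset.mem_sdiff, Finset.mem_insert, not_or] at hy
        exact Finset.mem_inter.2 ⟨mem_nbr.2 (hadj y hy.1 hy.2.1), Finset.mem_union_right _ hy.1⟩
      · rw [Finset.disjoint_left]
        intro y hy hy'
        simp only [Finset.mem_sdiff, Finset.mem_insert, not_or] at hy'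
        exact hy'.2.2 (Finset.mem_inter.1 hy).1
    · rw [if_neg hxs, add_zero]
      split_ifs with hx'
      · simp only [Finset.mem_sdiff, Finset.mem_insert, not_or, mem_nbr] at hx'
        rw [← Finset.card_insert_of_notMem (a := s) (by simp [G.adj_comm x s, hx'])]
        refine Finset.card_le_card (Finset.insert_subset ?_ (hsub x (Finset.mem_union_right _ hx)))
        exact Finset.mem_inter.2 ⟨mem_nbr.2 (hadj x hx hxs).symm, Finset.mem_union_right _ hs⟩
      · exact Finset.card_le_card (hsub x (Finset.mem_union_right _ hx))
  have h3 := Finset.sum_le_sum h2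
  rw [Finset.sum_add_distrib, Finset.sum_add_distrib, Finset.sum_ite_mem,
    Finset.inter_eq_right.2 Finset.sdiff_subset, Finset.sum_const, smul_eq_mul, mul_one,
    Finset.sum_ite_eq' S s, if_pos hs] at h3
  rw [degSum_restrict, Finset.sum_union hCS]
  omega

/-- Every graph supported on a set `S` of at least `r` vertices of `V` and without `K_{r+2}`-minor
has at most `r * |S| - r(r+1)/2` edges. -/
def EdgeBound (V : Type) [Fintype V] (r : ℕ) : Prop :=
  ∀ (G : SimpleGraph V) (S : Finset V), (∀ x y, G.Adj x y → x ∈ S) → r ≤ S.card →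
    ¬ G.HasCliqueMinor (r + 2) → G.degSum + r * (r + 1) ≤ 2 * r * S.card

lemma degSum_restrict_erase {G : SimpleGraph V} {L : Finset V} {x : V} (hx : x ∈ L) :
    (G.restrict L).degSum =
      (G.restrict ↑(L.erase x)).degSum + 2 * (G.nbr x ∩ L).card := by
  have h : ∀ y ∈ L.erase x, (G.nbr y ∩ L).card =
      (G.nbr y ∩ L.erase x).card + if y ∈ G.nbr x ∩ L then 1 else 0 := by
    intro y hy
    have hyL := Finset.mem_of_mem_erase hy
    rw [Finset.inter_erase]
    split_ifs with hxy
    · rw [Finset.card_erase_add_one]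
      simp only [Finset.mem_inter, mem_nbr] at hxy ⊢
      exact ⟨hxy.1.symm, hx⟩
    · rw [Finset.erase_eq_of_notMem, add_zero]
      simp only [Finset.mem_inter, mem_nbr] at hxy ⊢
      exact fun h => hxy ⟨h.1.symm, hyL⟩
  have h' : L.erase x ∩ (G.nbr x ∩ L) = G.nbr x ∩ L := by
    ext y
    have := G.ne_of_adj (a := x) (b := y)
    simp only [Finset.mem_inter, Finset.mem_erase, mem_nbr]
    tauto
  rw [degSum_restrict, degSum_restrict, ← Finset.add_sum_erase L _ hx, Finset.sum_congr rfl h,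
    Finset.sum_add_distrib, Finset.sum_ite_mem, h', Finset.sum_const, smul_eq_mul, mul_one]
  omega

/-- A graph on `8` or `9` vertices with minimum degree `5` and as few edges as possible has a vertex
`x` of degree `5` and an edge `yz` avoiding it such that `y` and `z` have at most one common
neighbour besides `x`. -/
lemma exists_sparse_edge {G : SimpleGraph V} {L : Finset V} (hd8 : 8 ≤ L.card) (hd9 : L.card ≤ 9)
    (hdeg : ∀ x ∈ L, 5 ≤ (G.nbr x ∩ L).card)
    (hsum : (G.restrict L).degSum ≤ 5 * L.card + 1) :
    ∃ x ∈ L, ∃ y ∈ L, ∃ z ∈ L, (G.nbr x ∩ L).card = 5 ∧ x ≠ y ∧ x ≠ z ∧ G.Adj y z ∧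
      (((G.nbr y ∩ G.nbr z) ∩ L).erase x).card ≤ 1 := by
  obtain ⟨w, hw⟩ : ∃ w, ∀ y ∈ L, y ≠ w → (G.nbr y ∩ L).card = 5 := by
    by_contra! hcon
    obtain ⟨x₀, -⟩ : L.Nonempty := Finset.card_pos.1 (by omega)
    obtain ⟨a, ha, -, ha5⟩ := hcon x₀
    obtain ⟨b, hb, hba, hb5⟩ := hcon a
    have ha5' := hdeg a ha
    have hb5' := hdeg b hb
    have hab : b ∈ L.erase a := Finset.mem_erase.2 ⟨hba, hb⟩
    have := Finset.card_nsmul_le_sum ((L.erase a).erase b) (fun y => (G.nbr y ∩ L).card) 5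
      fun y hy => hdeg y (Finset.mem_of_mem_erase (Finset.mem_of_mem_erase hy))
    rw [degSum_restrict, ← Finset.add_sum_erase L _ ha, ← Finset.add_sum_erase _ _ hab] at hsum
    rw [Finset.card_erase_of_mem hab, Finset.card_erase_of_mem ha, smul_eq_mul] at this
    omega
  set N : V → Finset V := fun y => L \ insert y (G.nbr y) with hN
  have memN : ∀ {a y}, a ∈ N y ↔ a ∈ L ∧ a ≠ y ∧ ¬ G.Adj y a := by
    intro a y
    simp [hN]
  have hNsub : ∀ y, N y ⊆ L := fun y => Finset.sdiff_subset
  have hNcard : ∀ y ∈ L, (N y).card + (G.nbr y ∩ L).card + 1 = L.card := by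
    intro y hy
    rw [add_assoc, ← Finset.card_insert_of_notMem (s := G.nbr y ∩ L) (a := y) (by simp),
      ← Finset.insert_inter_of_mem hy, Finset.inter_comm, Finset.card_sdiff_add_card_inter]
  obtain ⟨y, hy⟩ : (L.erase w).Nonempty := by
    rw [← Finset.card_pos]
    have := Finset.pred_card_le_card_erase (s := L) (a := w)
    omega
  obtain ⟨hyw, hyL⟩ := Finset.mem_erase.1 hy
  have hNy := hNcard y hyL
  rw [hw y hyL hyw] at hNy
  have hdouble : ∑ z ∈ L.erase y, (N y ∩ N z).card ≤ (N y).card * (L.card - 7) := by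
    have h1 : ∀ z, (N y ∩ N z).card = ∑ a ∈ N y, if a ∈ N z then 1 else 0 := by
      intro z
      rw [Finset.sum_ite_mem, Finset.sum_const, smul_eq_mul, mul_one]
    simp_rw [h1]
    rw [Finset.sum_comm, ← smul_eq_mul]
    refine Finset.sum_le_card_nsmul _ _ _ fun a ha => ?_
    have haL := hNsub y ha
    have hya : y ∈ N a := by
      rw [memN] at ha ⊢
      exact ⟨hyL, ha.2.1.symm, fun h => ha.2.2 h.symm⟩
    have h2 : ∑ z ∈ L.erase y, (if a ∈ N z then 1 else 0) ≤ ((N a).erase y).card := by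
      rw [← Finset.sum_filter, Finset.sum_const, smul_eq_mul, mul_one]
      refine Finset.card_le_card fun z hz => ?_
      simp only [Finset.mem_filter, Finset.mem_erase, memN] at hz ⊢
      exact ⟨hz.1.1, hz.1.2, hz.2.2.1.symm, fun h => hz.2.2.2 h.symm⟩
    have h3 := hNcard a haL
    have h4 := hdeg a haL
    rw [Finset.card_erase_of_mem hya] at h2
    omega
  obtain ⟨z, hz, hzcard⟩ : ∃ z ∈ (G.nbr y ∩ L).erase w, (N y ∩ N z).card ≤ L.card - 8 := by
    by_contra! hcon
    have h1 := Finset.card_nsmul_le_sum ((G.nbr y ∩ L).erase w) (fun z => (N y ∩ N z).card)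
      (L.card - 7) fun z hz => by have := hcon z hz; omega
    have h2 : ∑ z ∈ (G.nbr y ∩ L).erase w, (N y ∩ N z).card ≤
        ∑ z ∈ L.erase y, (N y ∩ N z).card := by
      refine Finset.sum_le_sum_of_subset fun z hz => ?_
      simp only [Finset.mem_erase, Finset.mem_inter, mem_nbr] at hz ⊢
      exact ⟨hz.2.1.ne', hz.2.2⟩
    have h3 := Finset.pred_card_le_card_erase (s := G.nbr y ∩ L) (a := w)
    rw [hw y hyL hyw] at h3
    rw [smul_eq_mul] at h1
    have h4 := Nat.mul_le_mul_right (L.card - 7) h3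
    rcases (by omega : L.card - 7 = 1 ∨ L.card - 7 = 2) with h | h <;>
      rw [h] at h1 h4 hdouble <;> omega
  simp only [Finset.mem_erase, Finset.mem_inter, mem_nbr] at hz
  obtain ⟨hzw, hyz, hzL⟩ := hz
  have hNz := hNcard z hzL
  rw [hw z hzL hzw] at hNz
  have hR : ((G.nbr y ∩ G.nbr z) ∩ L).card + 2 + (N y ∪ N z).card = L.card := by
    have hpair : ({y, z} : Finset V) ⊆ L := by
      simp [Finset.insert_subset_iff, hyL, hzL]
    have hdis : Disjoint {y, z} (N y ∪ N z) := by
      rw [Finset.disjoint_left]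
      intro a ha
      simp only [Finset.mem_insert, Finset.mem_singleton] at ha
      rw [Finset.mem_union, memN, memN]
      rcases ha with rfl | rfl
      · have := hyz.symm
        tauto
      · tauto
    have hsub : {y, z} ∪ (N y ∪ N z) ⊆ L :=
      Finset.union_subset hpair (Finset.union_subset (hNsub y) (hNsub z))
    rw [← Finset.card_pair hyz.ne, add_assoc, ← Finset.card_union_of_disjoint hdis,
      ← Finset.card_sdiff_add_card_eq_card hsub]
    congr 2
    ext a
    have h1 := G.ne_of_adj (a := y) (b := a)
    have h2 := G.ne_of_adj (a := z) (b := a)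
    simp only [Finset.mem_inter, Finset.mem_sdiff, Finset.mem_union, Finset.mem_insert,
      Finset.mem_singleton, mem_nbr, memN, ne_comm (a := y), ne_comm (a := z)] at h1 h2 ⊢
    tauto
  have hunion := Finset.card_union_add_card_inter (N y) (N z)
  by_cases hRcard : ((G.nbr y ∩ G.nbr z) ∩ L).card ≤ 1
  · obtain ⟨x, hx⟩ : (((L.erase y).erase z).erase w).Nonempty := by
      rw [← Finset.card_pos]
      have := Finset.pred_card_le_card_erase (s := L) (a := y)
      have := Finset.pred_card_le_card_erase (s := L.erase y) (a := z)
      have := Finset.pred_card_le_card_erase (s := (L.erase y).erase z) (a := w)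
      omega
    simp only [Finset.mem_erase] at hx
    exact ⟨x, hx.2.2.2, y, hyL, z, hzL, hw x hx.2.2.2 hx.1, hx.2.2.1, hx.2.1, hyz,
      (Finset.card_le_card (Finset.erase_subset _ _)).trans hRcard⟩
  · obtain ⟨x, hx⟩ : (((G.nbr y ∩ G.nbr z) ∩ L).erase w).Nonempty := by
      rw [← Finset.card_pos]
      have := Finset.pred_card_le_card_erase (s := (G.nbr y ∩ G.nbr z) ∩ L) (a := w)
      omega
    obtain ⟨hxw, hxR⟩ := Finset.mem_erase.1 hx
    have hx' := hxR
    simp only [Finset.mem_inter, mem_nbr] at hx'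
    refine ⟨x, hx'.2, y, hyL, z, hzL, hw x hx'.2 hxw, hx'.1.1.ne', hx'.1.2.ne', hyz, ?_⟩
    rw [Finset.card_erase_of_mem hxR]
    omega

/-- A non-complete graph on at most `2r - 1` vertices with minimum degree at least `r`, where
`r = q + 2 ≤ 5`, has a `K_r`-minor avoiding some non-dominating vertex. -/
lemma exists_hasCliqueMinor_erase {G : SimpleGraph V} {q : ℕ} (hq : q ≤ 3) (hb : EdgeBound V q)
    {L : Finset V} (hcard : L.card ≤ 2 * q + 3)
    (hdeg : ∀ x ∈ L, q + 2 ≤ (G.nbr x ∩ L).card) (hL : ¬ G.IsClique L) :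
    ∃ x ∈ L, (∃ y ∈ L, y ≠ x ∧ ¬ G.Adj x y) ∧
      (G.restrict ↑(L.erase x)).HasCliqueMinor (q + 2) := by
  by_contra! hcon
  have hle : ∀ x ∈ L, (G.nbr x ∩ L).card + 1 ≤ L.card := by
    intro x hx
    rw [← Finset.card_insert_of_notMem (s := G.nbr x ∩ L) (a := x) (by simp)]
    exact Finset.card_le_card (Finset.insert_subset hx Finset.inter_subset_right)
  have hdom : ∀ x ∈ L, (G.nbr x ∩ L).card + 2 ≤ L.card → ∃ y ∈ L, y ≠ x ∧ ¬ G.Adj x y := by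
    intro x hx h
    by_contra! hall
    have : L.erase x ⊆ G.nbr x ∩ L := by
      intro y hy
      rw [Finset.mem_erase] at hy
      exact Finset.mem_inter.2 ⟨mem_nbr.2 (hall y hy.2 hy.1), hy.2⟩
    have := Finset.card_le_card this
    rw [Finset.card_erase_of_mem hx] at this
    omega
  have hne : L.Nonempty := by
    rw [Finset.nonempty_iff_ne_empty]
    rintro rfl
    simp at hL
  obtain ⟨x, hx, hmin⟩ := L.exists_min_image (fun x => (G.nbr x ∩ L).card) hne
  have hx2 : (G.nbr x ∩ L).card + 2 ≤ L.card := by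
    by_contra! hlt
    refine hL fun a ha b hb hab => ?_
    have h1 := hmin a ha
    have h2 := hle a ha
    have : G.nbr a ∩ L = L.erase a := by
      refine Finset.eq_of_subset_of_card_le (fun c hc => ?_) ?_
      · simp only [Finset.mem_inter, mem_nbr, Finset.mem_erase] at hc ⊢
        exact ⟨hc.1.ne', hc.2⟩
      · rw [Finset.card_erase_of_mem ha]
        omega
    have hb' : b ∈ G.nbr a ∩ L := this ▸ Finset.mem_erase.2 ⟨hab.symm, hb⟩
    exact mem_nbr.1 (Finset.mem_inter.1 hb').1
  have hsupp : ∀ (x : V) (a b : V), (G.restrict ↑(L.erase x)).Adj a b → a ∈ L.erase x :=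
    fun x a b h => h.2.1
  have hcardx : ∀ x ∈ L, (L.erase x).card = L.card - 1 := fun x hx => Finset.card_erase_of_mem hx
  have hxdeg := hdeg x hx
  have h1 := hb _ _ (hsupp x) (by rw [hcardx x hx]; omega) (hcon x hx (hdom x hx hx2))
  have h2 := degSum_restrict_erase (G := G) hx
  have h3 := Finset.card_nsmul_le_sum L (fun y => (G.nbr y ∩ L).card) _ hmin
  rw [← degSum_restrict, smul_eq_mul] at h3
  rw [hcardx x hx] at h1
  obtain ⟨m, hm⟩ := (G.restrict (L : Set V)).even_degSum
  generalize hδ : (G.nbr x ∩ L).card = δ at *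
  have hspecial : q = 3 ∧ 8 ≤ L.card ∧ (G.restrict (L : Set V)).degSum ≤ 5 * L.card + 1 := by
    have hd : L.card ≤ 9 := by omega
    generalize L.card = d at *
    interval_cases q <;> interval_cases d <;> omega
  obtain ⟨rfl, hd8, hsum⟩ := hspecial
  obtain ⟨x, hx, y, hy, z, hz, hx5, hxy, hxz, hyz, hc⟩ :=
    exists_sparse_edge hd8 (by omega) hdeg hsum
  have hyz' : (G.restrict ↑(L.erase x)).Adj y z := by
    refine ⟨hyz, ?_, ?_⟩ <;> simp [hy, hz, hxy.symm, hxz.symm]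
  have hzmem : z ∈ L.erase x := Finset.mem_erase.2 ⟨hxz.symm, hz⟩
  have h4 := hb ((G.restrict ↑(L.erase x)).contract y z) ((L.erase x).erase z) ?_ ?_ ?_
  · have h5 := degSum_contract hyz'
    have h6 := degSum_restrict_erase (G := G) hx
    have h7 : (G.restrict ↑(L.erase x)).nbr y ∩ (G.restrict ↑(L.erase x)).nbr z ⊆
        ((G.nbr y ∩ G.nbr z) ∩ L).erase x := by
      intro a ha
      simp only [Finset.mem_inter, mem_nbr, Finset.mem_erase] at ha ⊢
      have h8 := ha.1.2.2
      simp only [Finset.coe_erase, Set.mem_sdiff, Set.mem_singleton_iff, Finset.mem_coe] at h8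
      exact ⟨h8.2, ⟨ha.1.1, ha.2.1⟩, h8.1⟩
    have h8 := (Finset.card_le_card h7).trans hc
    rw [Finset.card_erase_of_mem hzmem, hcardx x hx] at h4
    have h9 := Finset.card_nsmul_le_sum L (fun y => (G.nbr y ∩ L).card) 5 hdeg
    rw [← degSum_restrict, smul_eq_mul] at h9
    omega
  · rintro a b ⟨-, h5, -, h6 | ⟨rfl, -⟩ | ⟨-, h6⟩⟩
    · exact Finset.mem_erase.2 ⟨h5, h6.2.1⟩
    · exact Finset.mem_erase.2 ⟨h5, by simp [hy, hxy.symm]⟩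
    · exact Finset.mem_erase.2 ⟨h5, h6.2.2⟩
  · rw [Finset.card_erase_of_mem hzmem, hcardx x hx]
    omega
  · refine fun h => hcon x hx (hdom x hx (by omega)) (h.of_contract hyz' (by norm_num))

lemma exists_connected_closed (G : SimpleGraph V) {X : Set V} {v : V} (hv : v ∈ X) :
    ∃ D ⊆ X, v ∈ D ∧ (G.induce D).Connected ∧ ∀ y ∈ D, ∀ x ∈ X, G.Adj y x → x ∈ D := by
  obtain ⟨D, hD⟩ := (Set.toFinite {D : Set V | D ⊆ X ∧ v ∈ D ∧ (G.induce D).Connected}).exists_maximal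
    ⟨{v}, by simpa using hv, rfl, ⟨Preconnected.of_subsingleton⟩⟩
  obtain ⟨hDX, hvD, hDc⟩ := hD.prop
  refine ⟨D, hDX, hvD, hDc, fun y hy x hx hyx => ?_⟩
  exact hD.le_of_ge ⟨Set.insert_subset hx hDX, .inr hvD, connected_induce_insert hDc hy hyx⟩
    (Set.subset_insert x D) (Set.mem_insert x D)

/-- `C` is a nonempty union of components of `G` minus the closed neighbourhood of `v`. -/
structure IsFragment (G : SimpleGraph V) (v : V) (C : Finset V) : Prop where
  nonempty : C.Nonempty
  notMem : v ∉ C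
  disjoint : ∀ x ∈ C, ¬ G.Adj v x
  nbr_subset : ∀ x ∈ C, G.nbr x ⊆ C ∪ G.nbr v

/-- A fragment at a vertex of degree less than `2r` contains a vertex of degree less than `2r`,
where `r = q + 2`. -/
lemma IsFragment.exists_card_nbr_le {G : SimpleGraph V} {q : ℕ} (hq : q ≤ 3) {A : Finset V}
    (hA : ∀ x y, G.Adj x y → x ∈ A)
    (hedge : ∀ u v, G.Adj u v → q + 2 ≤ (G.nbr u ∩ G.nbr v).card)
    (hbound : ∀ (H : SimpleGraph V) (T : Finset V), (∀ x y, H.Adj x y → x ∈ T) →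
      T.card < A.card → q + 2 ≤ T.card → ¬ H.HasCliqueMinor (q + 4) →
      H.degSum + (q + 2) * (q + 3) ≤ 2 * (q + 2) * T.card)
    (hG : ¬ G.HasCliqueMinor (q + 4)) {v : V} {C : Finset V} (hvA : v ∈ A) (hCA : C ⊆ A)
    (hv : (G.nbr v).card ≤ 2 * q + 3) (hC : G.IsFragment v C) :
    ∃ u ∈ C, (G.nbr u).card ≤ 2 * q + 3 := by
  by_contra! hcon
  set S := (G.nbr v).filter fun s => ∃ x ∈ C, G.Adj x s with hS
  have memS : ∀ {s}, s ∈ S ↔ G.Adj v s ∧ ∃ x ∈ C, G.Adj x s := by simp [hS]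
  have hSv : S ⊆ G.nbr v := Finset.filter_subset _ _
  have hCS : Disjoint C S := by
    rw [Finset.disjoint_left]
    exact fun x hx hxS => hC.disjoint x hx (memS.1 hxS).1
  have hnbr : ∀ x ∈ C, G.nbr x ⊆ C ∪ S := by
    intro x hx y hy
    rcases Finset.mem_union.1 (hC.nbr_subset x hx hy) with h | h
    · exact Finset.mem_union_left _ h
    · exact Finset.mem_union_right _ (memS.2 ⟨mem_nbr.1 h, x, hx, mem_nbr.1 hy⟩)
  have hvS : v ∉ S := fun h => G.notMem_nbr_self v (hSv h)
  have hTcard : (C ∪ S).card = C.card + S.card := Finset.card_union_of_disjoint hCS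
  have hTlt : (C ∪ S).card < A.card := by
    refine Finset.card_lt_card ⟨Finset.union_subset hCA fun s hs => ?_, fun h => ?_⟩
    · exact hA s v (memS.1 hs).1.symm
    · have := h hvA
      simp [hC.notMem, hvS] at this
  have hTge : q + 2 ≤ (C ∪ S).card := by
    obtain ⟨x, hx⟩ := hC.nonempty
    have := Finset.card_le_card (hnbr x hx)
    have := hcon x hx
    omega
  have hsumC := Finset.card_nsmul_le_sum C (fun x => (G.nbr x).card) (2 * q + 4)
    fun x hx => hcon x hx
  have hsuppT : ∀ (H : SimpleGraph V) (a b : V), (H.restrict ↑(C ∪ S)).Adj a b → a ∈ C ∪ S :=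
    fun H a b h => h.2.1
  rcases S.eq_empty_or_nonempty with hSe | hSne
  · have h1 := hbound (G.restrict ↑(C ∪ S)) (C ∪ S) (hsuppT G) hTlt hTge
      fun h => hG (h.mono (restrict_le _ _))
    rw [hSe, Finset.union_empty] at h1 hnbr
    rw [degSum_restrict, Finset.sum_congr rfl fun x hx => by
      rw [Finset.inter_eq_left.2 (hnbr x hx)]] at h1
    rw [smul_eq_mul] at hsumC
    have : 0 < (q + 2) * (q + 3) := by positivity
    nlinarith
  · obtain ⟨s, hs, hmin⟩ := S.exists_min_image (fun x => (G.nbr x ∩ S).card) hSne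
    have hcontract := degSum_restrict_contract_ge hC.notMem hSv hCS hnbr hs
    have h1 := hbound ((G.contract s v).restrict ↑(C ∪ S)) (C ∪ S) (hsuppT _) hTlt hTge
      fun h => hG ((h.mono (restrict_le _ _)).of_contract (memS.1 hs).1.symm (by omega))
    have hQ : (S \ insert s (G.nbr s)).card + (G.nbr s ∩ S).card + 1 = S.card := by
      rw [add_assoc, ← Finset.card_insert_of_notMem (s := G.nbr s ∩ S) (a := s) (by simp),
        ← Finset.insert_inter_of_mem hs, Finset.inter_comm, Finset.card_sdiff_add_card_inter]
    have hT1 : ∀ x ∈ S, q + 3 ≤ (G.nbr x ∩ (C ∪ S)).card := by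
      intro x hx
      obtain ⟨-, c, hc, hcx⟩ := memS.1 hx
      have h2 := hedge _ _ hcx
      have h3 : insert c (G.nbr c ∩ G.nbr x) ⊆ G.nbr x ∩ (C ∪ S) := by
        refine Finset.insert_subset ?_ fun y hy => ?_
        · exact Finset.mem_inter.2 ⟨mem_nbr.2 hcx.symm, Finset.mem_union_left _ hc⟩
        · rw [Finset.mem_inter] at hy ⊢
          exact ⟨hy.2, hnbr c hc hy.1⟩
      have h4 := Finset.card_le_card h3
      rw [Finset.card_insert_of_notMem (by simp)] at h4
      omega
    have hT2 : ∀ x ∈ S, (G.nbr x ∩ S).card + 1 ≤ (G.nbr x ∩ (C ∪ S)).card := by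
      intro x hx
      obtain ⟨-, c, hc, hcx⟩ := memS.1 hx
      rw [← Finset.card_insert_of_notMem (s := G.nbr x ∩ S) (a := c)]
      · refine Finset.card_le_card (Finset.insert_subset ?_ ?_)
        · exact Finset.mem_inter.2 ⟨mem_nbr.2 hcx.symm, Finset.mem_union_left _ hc⟩
        · exact Finset.inter_subset_inter_left Finset.subset_union_right
      · exact fun h => Finset.disjoint_left.1 hCS hc (Finset.mem_inter.1 h).2
    have hfull : 2 * q + 3 ≤ S.card → q + 2 ≤ (G.nbr s ∩ S).card := by
      intro h
      have : S = G.nbr v := Finset.eq_of_subset_of_card_le hSv (by omega)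
      rw [this]
      exact hedge _ _ (memS.1 hs).1.symm
    have hs1 := Finset.card_nsmul_le_sum S _ _ hT1
    have hs2 := Finset.sum_le_sum hT2
    rw [Finset.sum_add_distrib, ← degSum_restrict, Finset.sum_const, smul_eq_mul, mul_one] at hs2
    have hs3 := Finset.card_nsmul_le_sum S (fun x => (G.nbr x ∩ S).card) _ hmin
    rw [← degSum_restrict] at hs3
    rw [smul_eq_mul] at hs1 hs3 hsumC
    obtain ⟨m, hm⟩ := (G.restrict (S : Set V)).even_degSum
    have hSle : S.card ≤ 9 := by
      have := Finset.card_le_card hSv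
      omega
    have hSle' : S.card ≤ 2 * q + 3 := (Finset.card_le_card hSv).trans hv
    rw [hTcard] at h1
    generalize S.card = n at *
    clear hTlt hTge hTcard
    interval_cases q <;> interval_cases n <;> omega

/-- A graph in which every edge is in at least `r = q + 2` triangles has a `K_{r+2}`-minor if it
has a vertex of degree less than `2r` and its minors on fewer vertices are sparse enough. -/
lemma hasCliqueMinor_of_edge_triangles {G : SimpleGraph V} {q : ℕ} (hq : q ≤ 3)
    (hb : EdgeBound V q) {A : Finset V} (hA : ∀ x y, G.Adj x y → x ∈ A)
    (hA' : ∀ x ∈ A, ∃ y, G.Adj x y)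
    (hedge : ∀ u v, G.Adj u v → q + 2 ≤ (G.nbr u ∩ G.nbr v).card)
    (hbound : ∀ (H : SimpleGraph V) (T : Finset V), (∀ x y, H.Adj x y → x ∈ T) →
      T.card < A.card → q + 2 ≤ T.card → ¬ H.HasCliqueMinor (q + 4) →
      H.degSum + (q + 2) * (q + 3) ≤ 2 * (q + 2) * T.card)
    (hlow : ∃ v ∈ A, (G.nbr v).card ≤ 2 * q + 3) : G.HasCliqueMinor (q + 4) := by
  by_contra hG
  have hfrag : ∀ {v C}, v ∈ A → C ⊆ A → (G.nbr v).card ≤ 2 * q + 3 → G.IsFragment v C →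
      ∃ u ∈ C, (G.nbr u).card ≤ 2 * q + 3 :=
    fun hvA hCA hv hC => hC.exists_card_nbr_le hq hA hedge hbound hG hvA hCA hv
  have hdeg : ∀ x ∈ A, q + 3 ≤ (G.nbr x).card := by
    intro x hx
    obtain ⟨y, hxy⟩ := hA' x hx
    have h1 : insert y (G.nbr x ∩ G.nbr y) ⊆ G.nbr x :=
      Finset.insert_subset (mem_nbr.2 hxy) Finset.inter_subset_left
    have h2 := Finset.card_le_card h1
    rw [Finset.card_insert_of_notMem (by simp)] at h2
    have := hedge _ _ hxy
    omega
  have hclique : ∀ v ∈ A, ¬ G.IsClique (G.nbr v) := by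
    intro v hv h
    refine hG (hasCliqueMinor_of_isClique (S := insert v (G.nbr v)) ?_ ?_)
    · rw [Finset.coe_insert]
      exact h.insert fun b hb _ => mem_nbr.1 hb
    · rw [Finset.card_insert_of_notMem (by simp)]
      have := hdeg v hv
      omega
  by_cases hex : ∃ n v C, v ∈ A ∧ C ⊆ A ∧ (G.nbr v).card ≤ 2 * q + 3 ∧ G.IsFragment v C ∧
      C.card = n
  · obtain ⟨v, C, hvA, hCA, hv, hC, hCn⟩ := Nat.find_spec hex
    have hmin : ∀ u C', u ∈ A → C' ⊆ A → (G.nbr u).card ≤ 2 * q + 3 → G.IsFragment u C' →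
        C.card ≤ C'.card := by
      intro u C' h1 h2 h3 h4
      rw [hCn]
      exact Nat.find_min' hex ⟨u, C', h1, h2, h3, h4, rfl⟩
    obtain ⟨u, huC, humin⟩ := C.exists_min_image (fun x => (G.nbr x).card) hC.nonempty
    have huA := hCA huC
    have hu : (G.nbr u).card ≤ 2 * q + 3 := by
      obtain ⟨w, hw, hwd⟩ := hfrag hvA hCA hv hC
      exact (humin w hw).trans hwd
    obtain ⟨D, hDX, hvD, hDc, hDcl⟩ := G.exists_connected_closed (X := {x | x ≠ u ∧ ¬ G.Adj u x})
      (v := v) ⟨fun h => hC.notMem (h ▸ huC), fun h => hC.disjoint u huC h.symm⟩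
    have hND : ∀ y ∈ G.nbr u, (∃ z ∈ G.nbr u, z ≠ y ∧ ¬ G.Adj y z) → ∃ w ∈ D, G.Adj w y := by
      rintro y hy ⟨z, hz, hzy, hyz⟩
      by_contra! hno
      have hyC : y ∈ C := by
        rcases Finset.mem_union.1 (hC.nbr_subset u huC hy) with h | h
        · exact h
        · exact absurd (mem_nbr.1 h) (hno v hvD)
      obtain ⟨w, hwy, hwu⟩ : ∃ w ∈ G.nbr y, w ∉ insert u (G.nbr u) := by
        by_contra! hall
        have h1 : G.nbr y ⊆ ((insert u (G.nbr u)).erase y).erase z := by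
          intro w hw
          rw [Finset.mem_erase, Finset.mem_erase]
          refine ⟨?_, (mem_nbr.1 hw).ne', hall w hw⟩
          rintro rfl
          exact hyz (mem_nbr.1 hw)
        have h2 := Finset.card_le_card h1
        rw [Finset.card_erase_of_mem (by simp [hzy, mem_nbr.1 hz]),
          Finset.card_erase_of_mem (by simp [mem_nbr.1 hy]),
          Finset.card_insert_of_notMem (by simp)] at h2
        have h3 := humin y hyC
        have h4 := hdeg u huA
        omega
      simp only [Finset.mem_insert, mem_nbr, not_or] at hwu hwy
      have hwD : w ∉ D := fun h => hno w h hwy.symm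
      have hwC : w ∈ C := by
        rcases Finset.mem_union.1 (hC.nbr_subset y hyC (mem_nbr.2 hwy)) with h | h
        · exact h
        · exact absurd (hDcl v hvD w hwu (mem_nbr.1 h)) hwD
      have hlt : (C.filter fun x => x ≠ u ∧ ¬ G.Adj u x ∧ x ∉ D).card < C.card :=
        Finset.card_lt_card (Finset.filter_ssubset.2 ⟨u, huC, by simp⟩)
      refine hlt.not_ge (hmin u _ huA ((Finset.filter_subset _ _).trans hCA) hu
        ⟨⟨w, Finset.mem_filter.2 ⟨hwC, hwu.1, hwu.2, hwD⟩⟩, by simp,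
          fun x hx => (Finset.mem_filter.1 hx).2.2.1, fun x hx a ha => ?_⟩)
      obtain ⟨hxC, hxu, hux, hxD⟩ := Finset.mem_filter.1 hx
      have hxa := mem_nbr.1 ha
      by_cases hau : G.Adj u a
      · exact Finset.mem_union_right _ (mem_nbr.2 hau)
      have hne : a ≠ u := fun h => hux (h ▸ hxa.symm)
      have haD : a ∉ D := fun h => hxD (hDcl a h x ⟨hxu, hux⟩ hxa.symm)
      refine Finset.mem_union_left _ (Finset.mem_filter.2 ⟨?_, hne, hau, haD⟩)
      rcases Finset.mem_union.1 (hC.nbr_subset x hxC ha) with h | h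
      · exact h
      · exact absurd (hDcl v hvD a ⟨hne, hau⟩ (mem_nbr.1 h)) haD
    obtain ⟨x, hxL, ⟨y, hyL, hyx, hxy⟩, hminor⟩ := exists_hasCliqueMinor_erase hq hb hu
      (fun x hx => hedge x u (mem_nbr.1 hx).symm) (hclique u huA)
    obtain ⟨w, hwD, hwx⟩ := hND x hxL ⟨y, hyL, hyx, hxy⟩
    have hux := mem_nbr.1 hxL
    have hDu : ∀ a ∈ D, a ≠ u ∧ ¬ G.Adj u a := hDX
    refine hG (hminor.add_two (P := {u}) (Q := insert x D) (by omega)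
      ⟨Preconnected.of_subsingleton⟩ (connected_induce_insert hDc hwD hwx) ?_ ?_ ?_
      ⟨u, rfl, x, Set.mem_insert _ _, hux⟩ ?_ ?_)
    · rw [Set.disjoint_singleton_left, Set.mem_insert_iff, not_or]
      exact ⟨hux.ne, fun h => (hDu u h).1 rfl⟩
    · simp
    · rw [Set.disjoint_left]
      rintro a (rfl | ha) haL
      · simp at haL
      · exact (hDu a ha).2 (by simpa using (Finset.mem_of_mem_erase haL))
    · exact fun a ha => ⟨u, rfl, mem_nbr.1 (Finset.mem_of_mem_erase ha)⟩
    · intro a ha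
      obtain ⟨hax, haL⟩ := Finset.mem_erase.1 ha
      by_cases hxa : G.Adj x a
      · exact ⟨x, Set.mem_insert _ _, hxa⟩
      · obtain ⟨b, hbD, hba⟩ := hND a haL ⟨x, hxL, hax.symm, fun h => hxa h.symm⟩
        exact ⟨b, Set.mem_insert_of_mem _ hbD, hba⟩
  · have hdom : ∀ v ∈ A, (G.nbr v).card ≤ 2 * q + 3 → A ⊆ insert v (G.nbr v) := by
      intro v hvA hv
      by_contra hsub
      refine hex ⟨_, v, A \ insert v (G.nbr v), hvA, Finset.sdiff_subset, hv,
        ⟨Finset.sdiff_nonempty.2 hsub, by simp, by simp, fun x hx a ha => ?_⟩, rfl⟩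
      by_cases hva : G.Adj v a
      · exact Finset.mem_union_right _ (mem_nbr.2 hva)
      · simp only [Finset.mem_sdiff, Finset.mem_insert, mem_nbr, not_or] at hx ha
        refine Finset.mem_union_left _ ?_
        simp only [Finset.mem_sdiff, Finset.mem_insert, mem_nbr, not_or]
        exact ⟨hA a x ha.symm, fun h => hx.2.2 (h ▸ ha.symm), hva⟩
    obtain ⟨v, hvA, hv⟩ := hlow
    have hAcard : A.card ≤ 2 * q + 4 := by
      have := Finset.card_le_card (hdom v hvA hv)
      rw [Finset.card_insert_of_notMem (by simp)] at this
      omega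
    have hsub : ∀ x ∈ A, insert x (G.nbr x) ⊆ A := fun x hx =>
      Finset.insert_subset hx fun y hy => hA y x (mem_nbr.1 hy).symm
    have hcard : ∀ x ∈ A, (G.nbr x).card + 1 ≤ A.card := by
      intro x hx
      rw [← Finset.card_insert_of_notMem (s := G.nbr x) (a := x) (by simp)]
      exact Finset.card_le_card (hsub x hx)
    refine hG (hasCliqueMinor_of_isClique (S := A) (fun x hx y hy hxy => ?_) ?_)
    · have hx' : x ∈ A := hx
      have := hdom x hx' (by have := hcard x hx'; omega) hy
      rw [Finset.mem_insert, mem_nbr] at this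
      exact this.resolve_left hxy.symm
    · have := hcard v hvA
      have := hdeg v hvA
      omega

lemma degSum_pos_iff {G : SimpleGraph V} : 0 < G.degSum ↔ ∃ x y, G.Adj x y := by
  simp only [degSum, Nat.pos_iff_ne_zero, ne_eq, Finset.sum_eq_zero_iff, Finset.mem_univ,
    true_imp_iff, Finset.card_eq_zero, not_forall, Finset.eq_empty_iff_forall_notMem, mem_nbr,
    not_not]

lemma exists_le_degSum_eq (G : SimpleGraph V) {a : ℕ} (ha : 2 * a ≤ G.degSum) :
    ∃ H ≤ G, H.degSum = 2 * a := by
  rw [degSum_eq_two_mul] at ha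
  obtain ⟨T, hT, rfl⟩ := Finset.exists_subset_card_eq (Nat.le_of_mul_le_mul_left ha two_pos)
  have hTG : (T : Set (Sym2 V)) ⊆ G.edgeSet := fun e he => mem_edgeFinset.1 (hT he)
  refine ⟨fromEdgeSet T, fun x y h => hTG ((fromEdgeSet_adj _).1 h).1, ?_⟩
  rw [degSum_eq_two_mul]
  congr 2
  ext e
  rw [mem_edgeFinset, edgeSet_fromEdgeSet, Set.mem_sdiff, Finset.mem_coe, and_iff_left_iff_imp]
  exact fun he hd => G.not_isDiag_of_mem_edgeSet (hTG he) hd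

lemma exists_card_nbr_lt {G : SimpleGraph V} {S : Finset V} {d : ℕ} (h : G.degSum < d * S.card) :
    ∃ v ∈ S, (G.nbr v).card < d := by
  by_contra! hcon
  have h1 := Finset.card_nsmul_le_sum S (fun v => (G.nbr v).card) d hcon
  have h2 : ∑ v ∈ S, (G.nbr v).card ≤ G.degSum := Finset.sum_le_sum_of_subset S.subset_univ
  rw [smul_eq_mul, mul_comm] at h1
  omega

/-- The edge bound follows if no `K_{r+2}`-minor-free graph is a minimal counterexample to it. -/
lemma edgeBound_of_minimal {r : ℕ}
    (h : ∀ (G : SimpleGraph V) (S : Finset V), (∀ x y, G.Adj x y → x ∈ S) → r ≤ S.card →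
      (∀ x ∈ S, ∃ y, G.Adj x y) →
      (∀ u v, G.Adj u v → r ≤ (G.nbr u ∩ G.nbr v).card) →
      (∀ (H : SimpleGraph V) (T : Finset V), (∀ x y, H.Adj x y → x ∈ T) →
        T.card < S.card → r ≤ T.card → ¬ H.HasCliqueMinor (r + 2) →
        H.degSum + r * (r + 1) ≤ 2 * r * T.card) →
      G.degSum + r * (r + 1) = 2 * r * S.card + 2 → G.HasCliqueMinor (r + 2)) :
    EdgeBound V r := by
  intro G S
  induction hn : S.card using Nat.strong_induction_on generalizing G S with
  | _ n ih =>
    subst hn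
    intro hS hr hG
    by_contra! hlt
    have hne : r ≠ S.card := by
      intro heq
      have h1 : G.degSum ≤ S.card * (S.card - 1) := by
        have h2 : G.degSum = ∑ x ∈ S, (G.nbr x).card := by
          refine (Finset.sum_subset S.subset_univ fun x _ hx => ?_).symm
          rw [Finset.card_eq_zero, Finset.eq_empty_iff_forall_notMem]
          exact fun y hy => hx (hS x y (mem_nbr.1 hy))
        rw [h2, ← smul_eq_mul]
        refine Finset.sum_le_card_nsmul _ _ _ fun x hx => ?_
        rw [← Finset.card_erase_of_mem hx]
        refine Finset.card_le_card fun y hy => Finset.mem_erase.2 ?_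
        exact ⟨(mem_nbr.1 hy).ne', hS y x (mem_nbr.1 hy).symm⟩
      rw [← heq] at h1 hlt
      cases r with
      | zero => simp at h1 hlt; omega
      | succ r =>
        simp only [Nat.add_sub_cancel] at h1
        nlinarith
    obtain ⟨m, hm⟩ := G.even_degSum
    obtain ⟨c, hc⟩ := Nat.even_mul_succ_self r
    obtain ⟨a, ha⟩ : ∃ a, a + c = r * S.card + 1 := by
      refine ⟨r * S.card + 1 - c, Nat.sub_add_cancel ?_⟩
      nlinarith [Nat.mul_le_mul_left r (Nat.lt_of_le_of_ne hr hne)]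
    have hassoc : 2 * r * S.card = 2 * (r * S.card) := mul_assoc _ _ _
    obtain ⟨H, hHG, hH⟩ := G.exists_le_degSum_eq (a := a) (by omega)
    have hHS : ∀ x y, H.Adj x y → x ∈ S := fun x y hxy => hS x y (hHG hxy)
    have hH' : H.degSum + r * (r + 1) = 2 * r * S.card + 2 := by omega
    have hHK : ¬ H.HasCliqueMinor (r + 2) := fun hK => hG (hK.mono hHG)
    have herase : ∀ x ∈ S, (S.erase x).card + 1 = S.card := fun x hx =>
      Finset.card_erase_add_one hx
    refine hHK (h H S hHS hr ?_ ?_ (fun H' T hT hlt => ih T.card hlt H' T rfl hT) hH')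
    · intro x hx
      by_contra! hiso
      have h1 := herase x hx
      have h2 := ih _ (by omega) H (S.erase x) rfl (mem_erase_of_adj hHS hiso) (by omega) hHK
      have h3 : 2 * r * (S.erase x).card ≤ 2 * r * S.card := Nat.mul_le_mul_left _ (by omega)
      omega
    · intro u v huv
      have h1 := herase v (hHS v u huv.symm)
      have h2 := ih _ (by omega) (H.contract u v) (S.erase v) rfl
        (mem_erase_of_contract_adj hHS huv) (by omega)
        fun hK => hHK (hK.of_contract huv (by omega))
      have h3 := degSum_contract huv
      rw [← h1, mul_add_one (2 * r)] at hH'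
      omega

/-- **Mader's theorem** for small cliques: for `r ≤ 5`, graphs without `K_{r+2}`-minor on `n ≥ r`
vertices have at most `rn - r(r+1)/2` edges. -/
theorem edgeBound : ∀ r ≤ 5, EdgeBound V r
  | 0, _ => by
    intro G S _ _ hG
    have : G.degSum = 0 := by
      by_contra hne
      obtain ⟨x, y, hxy⟩ := degSum_pos_iff.1 (Nat.pos_of_ne_zero hne)
      refine hG (hasCliqueMinor_of_isClique (S := {x, y}) ?_ (Finset.card_pair hxy.ne).ge)
      simpa [isClique_pair] using fun _ => hxy
    simp [this]
  | 1, _ => by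
    refine edgeBound_of_minimal fun G S _ hcard hiso hedge _ _ => ?_
    obtain ⟨x, hx⟩ := Finset.card_pos.1 hcard
    obtain ⟨y, hxy⟩ := hiso x hx
    obtain ⟨z, hz⟩ := Finset.card_pos.1 (hedge x y hxy)
    simp only [Finset.mem_inter, mem_nbr] at hz
    have := is3Clique_triple_iff.2 ⟨hxy, hz.1, hz.2⟩
    exact hasCliqueMinor_of_isClique this.1 this.2.ge
  | q + 2, hq => by
    refine edgeBound_of_minimal fun G S hS hcard hiso hedge hbound hdeg => ?_
    refine hasCliqueMinor_of_edge_triangles (by omega) (edgeBound q (by omega)) hS hiso hedge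
      hbound ?_
    obtain ⟨v, hv, hlt⟩ := exists_card_nbr_lt (G := G) (S := S) (d := 2 * (q + 2)) (by nlinarith)
    exact ⟨v, hv, by omega⟩

/-- The triangles of `G`. -/
noncomputable def triangles (G : SimpleGraph V) : Finset (Finset V) := {s | G.IsNClique 3 s}

lemma mem_triangles {G : SimpleGraph V} {s : Finset V} : s ∈ G.triangles ↔ G.IsNClique 3 s := by
  simp [triangles]

/-- Contracting an edge in `c` triangles destroys at most `c + c(c-1)/2` triangles. -/
lemma two_mul_card_triangles_le {G : SimpleGraph V} {u v : V} (huv : G.Adj u v) :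
    2 * G.triangles.card ≤ 2 * (G.contract u v).triangles.card +
      (G.nbr u ∩ G.nbr v).card * ((G.nbr u ∩ G.nbr v).card + 1) := by
  set M := insert u (G.nbr u ∩ G.nbr v) with hM
  have hMcard : M.card = (G.nbr u ∩ G.nbr v).card + 1 := Finset.card_insert_of_notMem (by simp)
  have h1 : (G.triangles.filter fun s => v ∈ s ∧ s.erase v ⊆ M).card ≤
      (M.powersetCard 2).card := by
    refine Finset.card_le_card_of_injOn (fun s => s.erase v) (fun s hs => ?_) fun s hs t ht h => ?_
    · obtain ⟨hs, hvs, hsM⟩ := Finset.mem_filter.1 hs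
      refine Finset.mem_powersetCard.2 ⟨hsM, ?_⟩
      rw [Finset.card_erase_of_mem hvs, (mem_triangles.1 hs).2]
    · rw [← Finset.insert_erase (Finset.mem_filter.1 hs).2.1,
        ← Finset.insert_erase (Finset.mem_filter.1 ht).2.1]
      exact congrArg (insert v) h
  have hexists : ∀ s, G.IsNClique 3 s → v ∈ s → ¬ s.erase v ⊆ M →
      u ∉ s ∧ ∃ x ∈ s.erase v, ¬ G.Adj u x := by
    intro s hs hvs hsM
    obtain ⟨x, hx, hxM⟩ := Finset.not_subset.1 hsM
    obtain ⟨hxv, hxs⟩ := Finset.mem_erase.1 hx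
    simp only [hM, Finset.mem_insert, Finset.mem_inter, mem_nbr, not_or, not_and] at hxM
    have hux : ¬ G.Adj u x := fun h => hxM.2 h (hs.1 hvs hxs hxv.symm)
    exact ⟨fun hus => hux (hs.1 hus hxs (Ne.symm hxM.1)), x, hx, hux⟩
  have h2 : (G.triangles.filter fun s => ¬ (v ∈ s ∧ s.erase v ⊆ M)).card ≤
      (G.contract u v).triangles.card := by
    refine Finset.card_le_card_of_injOn (fun s => if v ∈ s then insert u (s.erase v) else s)
      (fun s hs => ?_) fun s hs t ht h => ?_
    · obtain ⟨hs, hsM⟩ := Finset.mem_filter.1 hs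
      rw [mem_triangles] at hs
      have hclique : (G.contract u v).IsClique (s.erase v : Finset V) := by
        intro a ha b hb hab
        obtain ⟨hav, has⟩ := Finset.mem_erase.1 ha
        obtain ⟨hbv, hbs⟩ := Finset.mem_erase.1 hb
        exact ⟨hab, hav, hbv, .inl (hs.1 has hbs hab)⟩
      refine mem_triangles.2 ?_
      dsimp only
      split_ifs with hvs
      · obtain ⟨hus, -⟩ := hexists s hs hvs fun h => hsM ⟨hvs, h⟩
        refine ⟨?_, ?_⟩
        · rw [Finset.coe_insert]
          refine hclique.insert fun b hb hub => ?_
          obtain ⟨hbv, hbs⟩ := Finset.mem_erase.1 hb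
          exact ⟨hub, huv.ne, hbv, .inr (.inl ⟨rfl, hs.1 hvs hbs hbv.symm⟩)⟩
        · rw [Finset.card_insert_of_notMem (by simp [hus]), Finset.card_erase_of_mem hvs, hs.2]
      · rw [Finset.erase_eq_of_notMem hvs] at hclique
        exact ⟨hclique, hs.2⟩
    · have hne : ∀ s t, G.IsNClique 3 s → G.IsNClique 3 t → v ∈ s → ¬ s.erase v ⊆ M →
          insert u (s.erase v) ≠ t := by
        rintro s t hs ht hvs hsM rfl
        obtain ⟨hus, x, hx, hux⟩ := hexists s hs hvs hsM
        refine hux (ht.1 (Finset.mem_insert_self _ _) (Finset.mem_insert_of_mem hx) ?_)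
        rintro rfl
        exact hus (Finset.mem_of_mem_erase hx)
      obtain ⟨hs, hsM⟩ := Finset.mem_filter.1 hs
      obtain ⟨ht, htM⟩ := Finset.mem_filter.1 ht
      rw [mem_triangles] at hs ht
      dsimp only at h
      split_ifs at h with hvs hvt hvt
      · obtain ⟨hus, -⟩ := hexists s hs hvs fun h => hsM ⟨hvs, h⟩
        obtain ⟨hut, -⟩ := hexists t ht hvt fun h => htM ⟨hvt, h⟩
        have h' := congrArg (fun a => Finset.erase a u) h
        simp only [Finset.erase_insert (show u ∉ s.erase v by simp [hus]),
          Finset.erase_insert (show u ∉ t.erase v by simp [hut])] at h'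
        rw [← Finset.insert_erase hvs, h', Finset.insert_erase hvt]
      · exact absurd h (hne s t hs ht hvs fun h => hsM ⟨hvs, h⟩)
      · exact absurd h.symm (hne t s ht hs hvt fun h => htM ⟨hvt, h⟩)
      · exact h
  have h3 := Finset.card_filter_add_card_filter_not (s := G.triangles)
    fun s => v ∈ s ∧ s.erase v ⊆ M
  rw [Finset.card_powersetCard, hMcard, Nat.choose_two_right, Nat.add_sub_cancel] at h1
  have h4 := Nat.div_mul_le_self (((G.nbr u ∩ G.nbr v).card + 1) * (G.nbr u ∩ G.nbr v).card) 2
  rw [mul_comm (G.nbr u ∩ G.nbr v).card]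
  omega

/-- A graph with `m ≥ 1` edges and at least `m(q+1)/2` triangles has a `K_{q+4}`-minor, if
`q ≤ 3`. -/
theorem hasCliqueMinor_of_triangles {q : ℕ} (hq : q ≤ 3) (G : SimpleGraph V) (S : Finset V)
    (hS : ∀ x y, G.Adj x y → x ∈ S) (hpos : 0 < G.degSum)
    (htri : G.degSum * (q + 1) ≤ 4 * G.triangles.card) : G.HasCliqueMinor (q + 4) := by
  induction hn : S.card using Nat.strong_induction_on generalizing G S with
  | _ n ih =>
    subst hn
    by_contra hG
    have herase : ∀ x ∈ S, (S.erase x).card < S.card := fun x hx => Finset.card_erase_lt_of_mem hx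
    have hiso : ∀ x ∈ S, ∃ y, G.Adj x y := by
      intro x hx
      by_contra! hx'
      exact hG (ih _ (herase x hx) G (S.erase x) (mem_erase_of_adj hS hx') hpos htri rfl)
    have hedge : ∀ u v, G.Adj u v → q + 2 ≤ (G.nbr u ∩ G.nbr v).card := by
      intro u v huv
      have h1 := degSum_contract huv
      have h2 := two_mul_card_triangles_le huv
      rcases Nat.eq_zero_or_pos (G.contract u v).degSum with h0 | h0
      · have hno : ∀ x y, ¬ (G.contract u v).Adj x y := fun x y hxy =>
          h0.not_gt (degSum_pos_iff.2 ⟨x, y, hxy⟩)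
        have h3 : (G.contract u v).triangles.card = 0 := by
          rw [Finset.card_eq_zero, Finset.eq_empty_iff_forall_notMem]
          intro s hs
          obtain ⟨a, b, c, hab, -⟩ := is3Clique_iff.1 (mem_triangles.1 hs)
          exact hno a b hab
        have h4 : (G.nbr u ∩ G.nbr v).card = 0 := by
          rw [Finset.card_eq_zero, Finset.eq_empty_iff_forall_notMem]
          intro w hw
          simp only [Finset.mem_inter, mem_nbr] at hw
          exact hno u w ⟨hw.1.ne, huv.ne, hw.2.ne', .inl hw.1⟩
        rw [h4] at h1 h2
        nlinarith
      · have h3 : 4 * (G.contract u v).triangles.card < (G.contract u v).degSum * (q + 1) := by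
          by_contra! hle
          exact hG ((ih _ (herase v (hS v u huv.symm)) _ _ (mem_erase_of_contract_adj hS huv) h0
            hle rfl).of_contract huv (by omega))
        by_contra! hlt
        rw [h1] at htri
        nlinarith
    have hbound := edgeBound (V := V) (q + 2) (by omega)
    obtain ⟨x, y, hxy⟩ := degSum_pos_iff.1 hpos
    have hcard : q + 2 ≤ S.card := (hedge x y hxy).trans (Finset.card_le_card fun z hz =>
      hS z x (mem_nbr.1 (Finset.mem_inter.1 hz).1).symm)
    have hdeg := hbound G S hS hcard hG
    obtain ⟨v, hv, hlt⟩ := exists_card_nbr_lt (G := G) (S := S) (d := 2 * (q + 2)) (by nlinarith)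
    exact hG (hasCliqueMinor_of_edge_triangles hq (edgeBound q (by omega)) hS hiso hedge
      (fun H T hT _ => hbound H T hT) ⟨v, hv, by omega⟩)

end CliqueMinor

end SimpleGraph

/-- For every `4 ≤ k ≤ 7`, every finite simple graph with `m ≥ 1` edges and at
least `m(k-3)/2` triangles has a `K_k`-minor.  (The triangle count condition
`m(k-3)/2 ≤ t` is stated multiplied out as `m * (k - 3) ≤ 2 * t`, where `t` is
the number of 3-cliques of `G`.) -/
theorem statement6 {V : Type} [Fintype V] [DecidableEq V]
    (G : SimpleGraph V) [DecidableRel G.Adj]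
    (k : ℕ) (hk4 : 4 ≤ k) (hk7 : k ≤ 7)
    (hm : 1 ≤ G.edgeFinset.card)
    (ht : G.edgeFinset.card * (k - 3) ≤ 2 * (G.cliqueFinset 3).card) :
    (⊤ : SimpleGraph (Fin k)).MinorOf G := by
  obtain ⟨q, rfl⟩ := Nat.exists_eq_add_of_le' hk4
  have htri : G.triangles = G.cliqueFinset 3 := by
    ext s
    rw [mem_triangles, mem_cliqueFinset_iff]
  have hdeg := G.degSum_eq_two_mul
  refine hasCliqueMinor_of_triangles (by omega) G Finset.univ (fun x _ _ => Finset.mem_univ x)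
    (by omega) ?_
  rw [htri, hdeg, show q + 1 = q + 4 - 3 by omega]
  nlinarith
end
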